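/- arXiv:1504.07674 — 8 statements merged into one kernel-verified Lean document; each statement's English description precedes it below -/
import Mathlib

section
/- Let 𝔽 be a field, let R ≥ 0 and N ≥ 1 be integers, let c_0, …, c_{N−1} ∈ 𝔽 be nonzero, and let p_t(x) := t(c_0 x^R + ⋯ + c_{N−1} x^{R+N−1}) − x^{R+N}. Then for all u, v ∈ 𝔽^N, det p_t[u vᵀ] = t^{N−1} · Δ_N(u) · Δ_N(v) · Π_{j=1}^N c_{j−1} u_j^R v_j^R · (t − Σ_{j=0}^{N−1} e_{N−j}(u) · e_{N−j}(v) / c_j), where e_j denotes the elementary symmetric polynomial of degree j in N variables. -/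
noncomputable section

/-- The Vandermonde determinant `Δ_N(x) = det(x_i^{N-j})`. -/
def vand {𝔽 : Type*} [CommRing 𝔽] (N : ℕ) (x : Fin N → 𝔽) : 𝔽 :=
  (Matrix.of fun i k : Fin N => x i ^ (N - 1 - (k : ℕ))).det

/-- The elementary symmetric polynomial of degree `k` in `N` variables. -/
def esym {𝔽 : Type*} [CommRing 𝔽] (N : ℕ) (k : ℕ) (x : Fin N → 𝔽) : 𝔽 :=
  ∑ s ∈ (Finset.univ : Finset (Fin N)).powersetCard k, ∏ i ∈ s, x i

open Polynomial in
/-- Each coordinate `x i` is a root of `∏ k, (X - x k)`, whose coefficients are the signed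
elementary symmetric polynomials. -/
theorem pow_eq_neg_sum_esym {R : Type*} [CommRing R] (N : ℕ) (x : Fin N → R) (i : Fin N) :
    x i ^ N = -∑ j : Fin N, (-1) ^ (N - (j : ℕ)) * esym N (N - (j : ℕ)) x * x i ^ (j : ℕ) := by
  have hroot : (((Finset.univ.val.map x).map fun t => X - C t).prod).eval (x i) = 0 := by
    rw [eval_multiset_prod, Multiset.prod_eq_zero]
    simp only [Multiset.map_map, Multiset.mem_map]
    exact ⟨i, by simp, by simp⟩
  rw [Multiset.prod_X_sub_X_eq_sum_esymm, ← Finset.sum_range_reflect,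
    Finset.sum_range_succ] at hroot
  simp only [Finset.esymm_map_val, Multiset.card_map, Finset.card_val, Finset.card_univ,
    Fintype.card_fin, eval_add, eval_finsetSum, eval_mul, eval_pow, eval_neg, eval_one, eval_C,
    eval_X] at hroot
  rw [eq_neg_iff_add_eq_zero, ← hroot, add_comm]
  congr 1
  · rw [← Fin.sum_univ_eq_sum_range
      (fun j => (-1) ^ (N + 1 - 1 - j) * ((∑ t ∈ Finset.univ.powersetCard (N + 1 - 1 - j),
        ∏ k ∈ t, x k) * x i ^ (N - (N + 1 - 1 - j))))]
    refine Finset.sum_congr rfl fun j _ => ?_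
    rw [esym, mul_assoc, Nat.add_sub_cancel, Nat.sub_sub_self j.2.le]
  · simp

theorem vand_eq_sign_mul_det_vandermonde {R : Type*} [CommRing R] (N : ℕ) (x : Fin N → R) :
    vand N x = ((Equiv.Perm.sign (@Fin.revPerm N) : ℤˣ) : ℤ) * (Matrix.vandermonde x).det := by
  rw [← Matrix.det_permute', vand]
  congr 1
  ext i k
  simp only [Matrix.of_apply, Matrix.submatrix_apply, id, Matrix.vandermonde_apply,
    Fin.revPerm_apply, Fin.val_rev]
  congr 1
  omega

theorem vand_mul_vand {R : Type*} [CommRing R] (N : ℕ) (x y : Fin N → R) :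
    vand N x * vand N y = (Matrix.vandermonde x).det * (Matrix.vandermonde y).det := by
  rw [vand_eq_sign_mul_det_vandermonde, vand_eq_sign_mul_det_vandermonde, mul_mul_mul_comm,
    ← Int.cast_mul, ← Units.val_mul, Int.units_mul_self]
  simp

open Polynomial in
/-- The determinant of a rank one perturbation of the diagonal pencil `X • diagonal c`. -/
theorem det_diagonal_X_mul_C_sub_vecMulVec {n 𝔽 : Type*} [Fintype n] [DecidableEq n] [Nonempty n]
    [Field 𝔽] (c a b : n → 𝔽) (hc : ∀ j, c j ≠ 0) :
    (Matrix.diagonal (fun j => X * C (c j)) - (Matrix.vecMulVec a b).map C).det =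
      X ^ (Fintype.card n - 1) * C (∏ j, c j) * (X - C (∑ j, a j * b j / c j)) := by
  have hfactor : Matrix.diagonal (fun j => X * C (c j)) - (Matrix.vecMulVec a b).map C =
      Matrix.diagonal (fun j => C (c j)) *
        Matrix.charmatrix (Matrix.vecMulVec (fun j => a j / c j) b) := by
    ext1 i k
    have hcancel : C (c i) * C (a i / c i * b k) = C (a i * b k) := by
      rw [← C_mul, ← mul_assoc, mul_div_cancel₀ _ (hc i)]
    rw [Matrix.diagonal_mul, Matrix.charmatrix_apply, Matrix.sub_apply, Matrix.map_apply,
      Matrix.vecMulVec_apply, Matrix.vecMulVec_apply, mul_sub, hcancel]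
    rcases eq_or_ne i k with rfl | hik
    · rw [Matrix.diagonal_apply_eq, Matrix.diagonal_apply_eq, mul_comm]
    · rw [Matrix.diagonal_apply_ne _ hik, Matrix.diagonal_apply_ne _ hik, mul_zero]
  have hcharpoly := Matrix.charpoly_vecMulVec (fun j => a j / c j) b
  rw [Matrix.charpoly] at hcharpoly
  have hdot : (fun j => a j / c j) ⬝ᵥ b = ∑ j, a j * b j / c j :=
    Finset.sum_congr rfl fun j _ => div_mul_eq_mul_div _ _ _
  have hpow : (X : 𝔽[X]) ^ Fintype.card n = X ^ (Fintype.card n - 1) * X := by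
    rw [← pow_succ, Nat.sub_add_cancel Fintype.card_pos]
  rw [hfactor, Matrix.det_mul, Matrix.det_diagonal, hcharpoly, hdot, hpow, smul_eq_C_mul,
    map_prod C]
  ring

theorem stmt_11 (𝔽 : Type*) [Field 𝔽] (R N : ℕ) (hN : 1 ≤ N)
    (c : Fin N → 𝔽) (hc : ∀ j, c j ≠ 0)
    (u v : Fin N → 𝔽) :
    (Matrix.of fun i k : Fin N =>
        Polynomial.X * Polynomial.C (∑ j : Fin N, c j * (u i * v k) ^ (R + (j : ℕ)))
          - Polynomial.C ((u i * v k) ^ (R + N))).det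
      = Polynomial.X ^ (N - 1)
          * Polynomial.C (vand N u * vand N v * ∏ j : Fin N, c j * u j ^ R * v j ^ R)
          * (Polynomial.X - Polynomial.C (∑ j : Fin N,
              esym N (N - (j : ℕ)) u * esym N (N - (j : ℕ)) v / c j)) := by
  have : NeZero N := ⟨by omega⟩
  let a (x : Fin N → 𝔽) (j : Fin N) : 𝔽 := (-1) ^ (N - (j : ℕ)) * esym N (N - (j : ℕ)) x
  have hpow (x : Fin N → 𝔽) (i : Fin N) : x i ^ N = -∑ j, a x j * x i ^ (j : ℕ) :=
    pow_eq_neg_sum_esym N x i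
  have hfactor : (Matrix.of fun i k : Fin N =>
        Polynomial.X * Polynomial.C (∑ j : Fin N, c j * (u i * v k) ^ (R + (j : ℕ)))
          - Polynomial.C ((u i * v k) ^ (R + N))) =
      Matrix.diagonal (fun i => Polynomial.C (u i ^ R)) *
        ((Matrix.vandermonde u).map Polynomial.C *
          (Matrix.diagonal (fun j => Polynomial.X * Polynomial.C (c j)) -
            (Matrix.vecMulVec (a u) (a v)).map Polynomial.C) *
          ((Matrix.vandermonde v).map Polynomial.C).transpose) *
        Matrix.diagonal (fun k => Polynomial.C (v k ^ R)) := by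
    ext1 i k
    have hrank_one : (u i * v k) ^ N =
        ∑ l : Fin N, (∑ j : Fin N, u i ^ (j : ℕ) * (a u j * a v l)) * v k ^ (l : ℕ) := by
      rw [mul_pow, hpow u, hpow v, neg_mul_neg, Finset.sum_mul_sum, Finset.sum_comm]
      refine Finset.sum_congr rfl fun l _ => ?_
      rw [Finset.sum_mul]
      exact Finset.sum_congr rfl fun j _ => by ring
    rw [Matrix.mul_diagonal, Matrix.diagonal_mul, mul_sub, sub_mul, Matrix.sub_apply,
      Matrix.mul_apply, Matrix.mul_apply]
    simp only [Matrix.mul_diagonal]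
    simp only [Matrix.of_apply, Matrix.mul_apply, Matrix.transpose_apply,
      Matrix.map_apply, Matrix.vandermonde_apply, Matrix.vecMulVec_apply, ← Polynomial.C_mul,
      ← map_sum, pow_add (u i * v k) R, hrank_one]
    rw [mul_sub, sub_mul]
    congr 1
    · simp only [map_sum, Finset.mul_sum, Finset.sum_mul]
      refine Finset.sum_congr rfl fun j _ => ?_
      simp only [mul_pow, Polynomial.C_mul]
      ring
    · rw [← Polynomial.C_mul, ← Polynomial.C_mul, mul_pow]
      congr 1
      ring
  have hsum : ∑ j, a u j * a v j / c j =
      ∑ j : Fin N, esym N (N - (j : ℕ)) u * esym N (N - (j : ℕ)) v / c j := by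
    refine Finset.sum_congr rfl fun j _ => ?_
    rw [mul_mul_mul_comm, ← mul_pow, neg_one_mul, neg_neg, one_pow, one_mul]
  have hdet (x : Fin N → 𝔽) : ((Matrix.vandermonde x).map Polynomial.C).det =
      Polynomial.C (Matrix.vandermonde x).det := (RingHom.map_det Polynomial.C _).symm
  rw [hfactor]
  simp only [Matrix.det_mul, Matrix.det_transpose, Matrix.det_diagonal, hdet]
  rw [det_diagonal_X_mul_C_sub_vecMulVec c (a u) (a v) hc, hsum, vand_mul_vand,
    Fintype.card_fin]
  simp only [Finset.prod_mul_distrib, Polynomial.C_mul, map_prod]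
  ring
end
end

section
/- Fix integers M ≥ N ≥ 1 and let A be an N×N matrix over a field 𝔽, with rows a_1, …, a_N (each a vector in 𝔽^N). Then A^{∘M} = Σ_{j=0}^{N−1} D_{M,j}(A) · A^{∘j}, where D_{M,j}(A) is the diagonal matrix (−1)^{N−j−1} · diag(s_{μ(M,N,j)}(a_1), …, s_{μ(M,N,j)}(a_N)). -/
noncomputable section

open MvPolynomial

/-- The hook partition `μ(M,N,j) = (M−N+1, 1, …, 1, 0, …, 0)` with `N−j−1` ones after the
first entry and `j` trailing zeros (indexed from 0). -/
def hookMu (M N j : ℕ) (k : Fin N) : ℕ :=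
  if (k : ℕ) = 0 then M - N + 1 else if (k : ℕ) < N - j then 1 else 0

/-- `S` is the Schur polynomial of the partition `lam` (with at most `N` parts):
the unique polynomial with `S · Δ_N(x) = det(x_i^{lam_j + N − j})`. -/
def IsSchur {𝔽 : Type*} [CommRing 𝔽] (N : ℕ) (lam : Fin N → ℕ)
    (S : MvPolynomial (Fin N) 𝔽) : Prop :=
  S * (Matrix.of fun i k : Fin N => (X i : MvPolynomial (Fin N) 𝔽) ^ (N - 1 - (k : ℕ))).det
    = (Matrix.of fun i k : Fin N =>
        (X i : MvPolynomial (Fin N) 𝔽) ^ (lam k + (N - 1 - (k : ℕ)))).det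

/-- The `N × N` matrix of monomials `x_i ^ (e k)`. -/
def monomialMatrix (R : Type*) [CommRing R] {N : ℕ} (e : Fin N → ℕ) :
    Matrix (Fin N) (Fin N) (MvPolynomial (Fin N) R) :=
  Matrix.of fun i k => X i ^ e k

theorem det_monomialMatrix_rev_ne_zero (R : Type*) [CommRing R] [IsDomain R] (N : ℕ) :
    (monomialMatrix R fun k : Fin N => N - 1 - (k : ℕ)).det ≠ 0 := by
  have h : (monomialMatrix R fun k : Fin N => N - 1 - (k : ℕ)) =
      (Matrix.vandermonde (X : Fin N → MvPolynomial (Fin N) R)).submatrix id Fin.revPerm := by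
    ext1 i k
    simp only [monomialMatrix, Matrix.of_apply, Matrix.submatrix_apply, id_eq,
      Matrix.vandermonde_apply, Fin.revPerm_apply, Fin.val_rev]
    congr 1
    omega
  rw [h, Matrix.det_permute']
  refine mul_ne_zero ?_ (Matrix.det_vandermonde_ne_zero_iff.mpr (X_injective))
  rcases Int.units_eq_one_or (Equiv.Perm.sign (Fin.revPerm : Equiv.Perm (Fin N))) with h | h <;>
    simp [h]

/-- Replacing the column of exponent `j` of the Vandermonde matrix by the column of `M`-th powers
gives, up to a cyclic permutation of columns, the alternant of the hook `μ(M,N,j)`. -/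
theorem cramer_monomialMatrix (R : Type*) [CommRing R] {M N : ℕ} (hM : N ≤ M) (j : Fin N) :
    (monomialMatrix R fun k : Fin N => N - 1 - (k : ℕ)).cramer (fun i => X i ^ M) j.rev =
      (-1) ^ (N - 1 - (j : ℕ)) *
        (monomialMatrix R fun k => hookMu M N j k + (N - 1 - (k : ℕ))).det := by
  have : NeZero N := ⟨j.pos.ne'⟩
  have h : (monomialMatrix R fun k : Fin N => N - 1 - (k : ℕ)).updateCol j.rev (fun i => X i ^ M) =
      (monomialMatrix R fun k => hookMu M N j k + (N - 1 - (k : ℕ))).submatrix id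
        (Fin.cycleRange j.rev) := by
    ext1 i k
    have hj := j.isLt
    have hk := k.isLt
    rcases lt_trichotomy k j.rev with h | h | h
    · rw [Matrix.updateCol_ne h.ne]
      have hv := Fin.coe_cycleRange_of_lt h
      rw [Fin.lt_def, Fin.val_rev] at h
      simp only [monomialMatrix, Matrix.of_apply, Matrix.submatrix_apply, id_eq, hv, hookMu]
      rw [if_neg (by omega), if_pos (by omega)]
      congr 1
      omega
    · subst h
      simp only [monomialMatrix, Matrix.updateCol_self, Matrix.of_apply, Matrix.submatrix_apply,
        id_eq, Fin.cycleRange_self, hookMu, Fin.val_zero, if_true]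
      congr 1
      omega
    · rw [Matrix.updateCol_ne h.ne', Matrix.submatrix_apply, Fin.cycleRange_of_gt h]
      rw [Fin.lt_def, Fin.val_rev] at h
      simp only [monomialMatrix, Matrix.of_apply, id_eq, hookMu]
      rw [if_neg (by omega), if_neg (by omega), zero_add]
  rw [Matrix.cramer_apply, h, Matrix.det_permute', Fin.sign_cycleRange, Fin.val_rev]
  have : N - (j + 1 : ℕ) = N - 1 - j := by omega
  simp [this]

/-- Each variable satisfies `x_i ^ M = ∑ j, (-1) ^ (N - 1 - j) s_{μ(M,N,j)} x_i ^ j`. -/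
theorem X_pow_eq_sum_hook_schur {R : Type*} [CommRing R] [IsDomain R] {M N : ℕ} (hM : N ≤ M)
    {S : Fin N → MvPolynomial (Fin N) R} (hS : ∀ j : Fin N, IsSchur N (hookMu M N j) (S j))
    (i : Fin N) :
    (X i : MvPolynomial (Fin N) R) ^ M =
      ∑ j : Fin N, (-1) ^ (N - 1 - (j : ℕ)) * S j * X i ^ (j : ℕ) := by
  apply mul_left_cancel₀ (det_monomialMatrix_rev_ne_zero R N)
  have h := congrFun (Matrix.mulVec_cramer (monomialMatrix R fun k : Fin N => N - 1 - (k : ℕ))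
    fun i => X i ^ M) i
  rw [Pi.smul_apply, smul_eq_mul] at h
  rw [← h, Matrix.mulVec, dotProduct, ← Equiv.sum_comp Fin.revPerm, Finset.mul_sum]
  refine Finset.sum_congr rfl fun j _ => ?_
  have hdet : S j * (monomialMatrix R fun k : Fin N => N - 1 - (k : ℕ)).det =
      (monomialMatrix R fun k => hookMu M N j k + (N - 1 - (k : ℕ))).det := hS j
  have hj : N - 1 - (N - (j + 1 : ℕ)) = j := by omega
  rw [Fin.revPerm_apply, cramer_monomialMatrix R hM, ← hdet]
  simp only [monomialMatrix, Matrix.of_apply, Fin.val_rev, hj]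
  ring

theorem stmt_12 (𝔽 : Type*) [Field 𝔽] (M N : ℕ) (hN : 1 ≤ N) (hM : N ≤ M)
    (A : Matrix (Fin N) (Fin N) 𝔽)
    (S : Fin N → MvPolynomial (Fin N) 𝔽)
    (hS : ∀ j : Fin N, IsSchur N (hookMu M N (j : ℕ)) (S j)) :
    (Matrix.of fun i k : Fin N => A i k ^ M)
      = ∑ j : Fin N,
          Matrix.diagonal (fun i : Fin N =>
              (-1 : 𝔽) ^ (N - 1 - (j : ℕ)) * MvPolynomial.eval (fun k => A i k) (S j))
            * Matrix.of (fun i k : Fin N => A i k ^ (j : ℕ)) := by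
  ext r k
  have h := congrArg (eval fun k => A r k) (X_pow_eq_sum_hook_schur hM hS k)
  simpa [Matrix.sum_apply, Matrix.diagonal_mul] using h
end
end

section
/- Given non-negative integers m < n < p, let f(x) = c_m x^m + c_n x^n + c_p x^p with real coefficients and c_m, c_n nonzero. The following are equivalent: (1) f[A] is positive semidefinite for every A ∈ 𝒫_2([0,1]); (2) f[A] is positive semidefinite for every A ∈ 𝒫_2^1([0,1]); (3) c_m > 0, c_n > 0, and c_p ≥ −c_m c_n (n−m)² / (c_m (p−m)² + c_n (p−n)²). -/
theorem pow_sub_pow_le_ratio {s r : ℕ} (hsr : s ≤ r) {a b : ℝ} (hb : 0 ≤ b) (hba : b ≤ a)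
    (ha : a ≤ 1) : (s : ℝ) * (a ^ r - b ^ r) ≤ r * (a ^ s - b ^ s) := by
  have hmono : MonotoneOn (fun x : ℝ => r * x ^ s - s * x ^ r) (Set.Icc 0 1) := by
    refine monotoneOn_of_deriv_nonneg (convex_Icc 0 1) (by fun_prop) (by fun_prop) ?_
    intro x hx
    rw [interior_Icc] at hx
    have hd : HasDerivAt (fun x : ℝ => r * x ^ s - s * x ^ r)
        (r * (s * x ^ (s - 1)) - s * (r * x ^ (r - 1))) x :=
      ((hasDerivAt_pow s x).const_mul _).sub ((hasDerivAt_pow r x).const_mul _)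
    rw [hd.deriv]
    have h := pow_le_pow_of_le_one hx.1.le hx.2.le (Nat.sub_le_sub_right hsr 1)
    have h2 : (0 : ℝ) ≤ r * s := by positivity
    nlinarith [mul_le_mul_of_nonneg_left h h2]
  have := hmono ⟨hb, hba.trans ha⟩ ⟨hb.trans hba, ha⟩ hba
  simp only at this
  linarith

theorem weighted_pow_mul_pow_le (s q : ℕ) {a b : ℝ} (hb : 0 ≤ b) (hba : b ≤ a) :
    ((s : ℝ) + q) * (b ^ s * a ^ q) ≤ q * a ^ (s + q) + s * b ^ (s + q) := by
  rcases (hb.trans hba).eq_or_lt with ha | ha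
  · obtain rfl : b = a := le_antisymm hba (ha ▸ hb)
    rw [pow_add]; linarith
  · obtain ⟨t, rfl⟩ : ∃ t, b = t * a := ⟨b / a, by field_simp⟩
    have ht0 : 0 ≤ t := by by_contra! h; nlinarith
    have ht1 : t ≤ 1 := by by_contra! h; nlinarith
    have h := pow_sub_pow_le_ratio (Nat.le_add_right s q) ht0 ht1 le_rfl
    have h2 : (0 : ℝ) ≤ a ^ (s + q) := by positivity
    have h3 := mul_le_mul_of_nonneg_left h h2
    simp only [one_pow, mul_pow, pow_add] at *
    push_cast at h3
    nlinarith

/-- For three exponents `m < n < p`, the generalized Vandermonde minors involving `p` are controlled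
on `[0, 1]` by the one for `m` and `n`, with the constants obtained in the limit `a, b → 1`. -/
theorem mul_pow_sub_sq_le {m n p : ℕ} (hmn : m < n) (hnp : n < p) {a b : ℝ}
    (ha : a ∈ Set.Icc (0 : ℝ) 1) (hb : b ∈ Set.Icc (0 : ℝ) 1) :
    ((n : ℝ) - m) ^ 2 * (a ^ m * b ^ p - a ^ p * b ^ m) ^ 2
        ≤ ((p : ℝ) - m) ^ 2 * (a ^ m * b ^ n - a ^ n * b ^ m) ^ 2 ∧
    ((n : ℝ) - m) ^ 2 * (a ^ n * b ^ p - a ^ p * b ^ n) ^ 2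
        ≤ ((p : ℝ) - n) ^ 2 * (a ^ m * b ^ n - a ^ n * b ^ m) ^ 2 := by
  wlog hba : b ≤ a generalizing a b
  · have := this hb ha (le_of_not_ge hba)
    constructor
    · linear_combination this.1
    · linear_combination this.2
  obtain ⟨s, rfl⟩ := Nat.exists_eq_add_of_lt hmn
  obtain ⟨q, rfl⟩ := Nat.exists_eq_add_of_lt hnp
  generalize hs : s + 1 = s' at *
  generalize hq : q + 1 = q' at *
  simp only [add_assoc, hs, hq]
  push_cast
  obtain ⟨ha0, ha1⟩ := ha
  obtain ⟨hb0, hb1⟩ := hb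
  have h1 := pow_sub_pow_le_ratio (Nat.le_add_right s' q') hb0 hba ha1
  have h2 := weighted_pow_mul_pow_le s' q' hb0 hba
  have hX : 0 ≤ a ^ s' - b ^ s' := sub_nonneg.2 (pow_le_pow_left₀ hb0 hba _)
  have hY : 0 ≤ a ^ (s' + q') - b ^ (s' + q') := sub_nonneg.2 (pow_le_pow_left₀ hb0 hba _)
  have hZ : 0 ≤ a ^ q' - b ^ q' := sub_nonneg.2 (pow_le_pow_left₀ hb0 hba _)
  have hA : a ^ (s' + q') ≤ 1 := pow_le_one₀ ha0 ha1
  have h3 : (s' : ℝ) * (a ^ s' * b ^ s' * (a ^ q' - b ^ q')) ≤ q' * (a ^ s' - b ^ s') := by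
    have e1 := mul_le_mul_of_nonneg_left h2 (pow_nonneg ha0 s')
    have e2 := mul_le_mul_of_nonneg_right hA (mul_nonneg (Nat.cast_nonneg (α := ℝ) q') hX)
    simp only [pow_add] at e1 e2
    linarith
  have k1 := pow_le_pow_left₀ (by positivity) h1 2
  have k3 := pow_le_pow_left₀ (by positivity) h3 2
  have hw : 0 ≤ (a ^ m * b ^ m) ^ 2 := by positivity
  have l1 := mul_le_mul_of_nonneg_left k1 hw
  have l3 := mul_le_mul_of_nonneg_left k3 hw
  simp only [pow_add] at l1 l3 ⊢
  push_cast at l1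
  constructor
  · linear_combination l1
  · linear_combination l3

theorem posSemidef_fin_two_iff (A : Matrix (Fin 2) (Fin 2) ℝ) :
    A.PosSemidef ↔ A 1 0 = A 0 1 ∧ 0 ≤ A 0 0 ∧ 0 ≤ A 1 1 ∧ A 0 1 ^ 2 ≤ A 0 0 * A 1 1 := by
  constructor
  · intro h
    have h1 : A 1 0 = A 0 1 := by simpa using h.1.apply 0 1
    have h2 := h.det_nonneg
    rw [Matrix.det_fin_two, h1] at h2
    exact ⟨h1, h.diag_nonneg, h.diag_nonneg, by linarith⟩
  · rintro ⟨h1, h2, h3, h4⟩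
    refine Matrix.PosSemidef.of_dotProduct_mulVec_nonneg ?_ ?_
    · ext i j
      fin_cases i <;> fin_cases j <;> simp [h1]
    · intro x
      simp only [dotProduct, Matrix.mulVec, Fin.sum_univ_two, Pi.star_apply, star_trivial, h1]
      rcases h2.eq_or_lt with h | h
      · rw [← h] at h4 ⊢
        have : A 0 1 = 0 := by nlinarith
        rw [this]
        nlinarith [mul_nonneg h3 (sq_nonneg (x 1))]
      · refine nonneg_of_mul_nonneg_right (a := A 0 0) ?_ h
        nlinarith [sq_nonneg (A 0 0 * x 0 + A 0 1 * x 1),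
          mul_nonneg (sub_nonneg.2 h4) (sq_nonneg (x 1))]

theorem det_trinomial (m n p : ℕ) (cm cn cp a b : ℝ) :
    (cm * (a * a) ^ m + cn * (a * a) ^ n + cp * (a * a) ^ p) *
        (cm * (b * b) ^ m + cn * (b * b) ^ n + cp * (b * b) ^ p) -
      (cm * (a * b) ^ m + cn * (a * b) ^ n + cp * (a * b) ^ p) ^ 2 =
    cm * cn * (a ^ m * b ^ n - a ^ n * b ^ m) ^ 2 + cm * cp * (a ^ m * b ^ p - a ^ p * b ^ m) ^ 2 +
      cn * cp * (a ^ n * b ^ p - a ^ p * b ^ n) ^ 2 := by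
  simp only [mul_pow]
  ring

open Filter Topology

theorem trinomial_coeff_of_rank_one {m n p : ℕ} (hmn : m < n) (hnp : n < p)
    {cm cn cp : ℝ} (hcm : cm ≠ 0) (hcn : cn ≠ 0)
    (hf : ∀ x ∈ Set.Icc (0 : ℝ) 1, 0 ≤ cm * x ^ m + cn * x ^ n + cp * x ^ p)
    (hD : ∀ a ∈ Set.Icc (0 : ℝ) 1, ∀ b ∈ Set.Icc (0 : ℝ) 1,
      0 ≤ cm * cn * (a ^ m * b ^ n - a ^ n * b ^ m) ^ 2 +
        cm * cp * (a ^ m * b ^ p - a ^ p * b ^ m) ^ 2 +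
        cn * cp * (a ^ n * b ^ p - a ^ p * b ^ n) ^ 2) :
    0 < cm ∧ 0 < cn ∧ -(cm * cn * ((n : ℝ) - (m : ℝ)) ^ 2)
      / (cm * ((p : ℝ) - (m : ℝ)) ^ 2 + cn * ((p : ℝ) - (n : ℝ)) ^ 2) ≤ cp := by
  have hmem : ∀ᶠ x in 𝓝[>] (0 : ℝ), x ∈ Set.Ioo (0 : ℝ) 1 := Ioo_mem_nhdsGT one_pos
  have hm : 0 < cm := by
    refine lt_of_le_of_ne ?_ hcm.symm
    have hc : Tendsto (fun x : ℝ => cm + cn * x ^ (n - m) + cp * x ^ (p - m)) (𝓝[>] 0) (𝓝 cm) := by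
      have : ContinuousAt (fun x : ℝ => cm + cn * x ^ (n - m) + cp * x ^ (p - m)) 0 := by fun_prop
      have h := this.tendsto
      simp only [zero_pow (Nat.sub_ne_zero_of_lt hmn),
        zero_pow (Nat.sub_ne_zero_of_lt (hmn.trans hnp)), mul_zero, add_zero] at h
      exact h.mono_left nhdsWithin_le_nhds
    refine ge_of_tendsto hc ?_
    filter_upwards [hmem] with x hx
    refine nonneg_of_mul_nonneg_right (a := x ^ m) ?_ (pow_pos hx.1 m)
    have h := hf x ⟨hx.1.le, hx.2.le⟩
    rw [← Nat.add_sub_cancel' hmn.le, ← Nat.add_sub_cancel' (hmn.trans hnp).le,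
      pow_add, pow_add] at h
    linarith
  have hn : 0 < cn := by
    refine lt_of_le_of_ne ?_ hcn.symm
    set X : ℝ := (1 / 2) ^ n - (1 / 2) ^ m
    set Y : ℝ := (1 / 2) ^ p - (1 / 2) ^ m
    set Z : ℝ := (1 / 2) ^ p - (1 / 2) ^ n
    have hX0 : X ≠ 0 :=
      sub_ne_zero.2 (pow_lt_pow_right_of_lt_one₀ (by norm_num) (by norm_num) hmn).ne
    have hc : Tendsto (fun x : ℝ => cm * cn * X ^ 2 + cm * cp * (x ^ (p - n) * Y) ^ 2 +
        cn * cp * (x ^ (p - m) * Z) ^ 2) (𝓝[>] 0) (𝓝 (cm * cn * X ^ 2)) := by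
      have : ContinuousAt (fun x : ℝ => cm * cn * X ^ 2 + cm * cp * (x ^ (p - n) * Y) ^ 2 +
        cn * cp * (x ^ (p - m) * Z) ^ 2) 0 := by fun_prop
      have h := this.tendsto
      simp only [zero_pow (Nat.sub_ne_zero_of_lt hnp), zero_pow two_ne_zero, zero_mul,
        zero_pow (Nat.sub_ne_zero_of_lt (hmn.trans hnp)), mul_zero, add_zero] at h
      exact h.mono_left nhdsWithin_le_nhds
    have h : 0 ≤ cm * cn * X ^ 2 := by
      refine ge_of_tendsto hc ?_
      filter_upwards [hmem] with x hx
      have hx0 := hx.1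
      refine nonneg_of_mul_nonneg_right (a := (x ^ m * x ^ n) ^ 2) ?_ (by positivity)
      have h := hD x ⟨hx.1.le, hx.2.le⟩ (x * (1 / 2)) ⟨by linarith, by linarith [hx.2]⟩
      have e1 : x ^ p = x ^ n * x ^ (p - n) := by rw [← pow_add, Nat.add_sub_cancel' hnp.le]
      have e2 : x ^ p = x ^ m * x ^ (p - m) := by
        rw [← pow_add, Nat.add_sub_cancel' (hmn.trans hnp).le]
      have d1 : x ^ m * (x * (1 / 2)) ^ n - x ^ n * (x * (1 / 2)) ^ m = x ^ m * x ^ n * X := by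
        rw [mul_pow, mul_pow]; ring
      have d2 : x ^ m * (x * (1 / 2)) ^ p - x ^ p * (x * (1 / 2)) ^ m =
          x ^ m * x ^ n * (x ^ (p - n) * Y) := by
        rw [mul_pow, mul_pow, e1]; ring
      have d3 : x ^ n * (x * (1 / 2)) ^ p - x ^ p * (x * (1 / 2)) ^ n =
          x ^ m * x ^ n * (x ^ (p - m) * Z) := by
        rw [mul_pow, mul_pow, e2]; ring
      rw [d1, d2, d3] at h
      linarith
    have hX2 : 0 < X ^ 2 := by positivity
    exact nonneg_of_mul_nonneg_right (nonneg_of_mul_nonneg_left h hX2) hm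
  refine ⟨hm, hn, ?_⟩
  have hpm : (0 : ℝ) < p - m := sub_pos.2 (by exact_mod_cast hmn.trans hnp)
  rw [div_le_iff₀ (by positivity)]
  have hslope : ∀ i j : ℕ, Tendsto (fun b : ℝ => (b - 1)⁻¹ * (b ^ j - b ^ i)) (𝓝[<] 1)
      (𝓝 ((j : ℝ) - i)) := by
    intro i j
    have hd := ((hasDerivAt_pow j (1 : ℝ)).sub (hasDerivAt_pow i (1 : ℝ)))
    rw [hasDerivAt_iff_tendsto_slope] at hd
    have := hd.mono_left (nhdsWithin_mono 1 (fun x (hx : x ∈ Set.Iio 1) => ne_of_lt hx))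
    simpa [slope_fun_def] using this
  have hlim := ((((hslope m n).pow 2).const_mul (cm * cn)).add
    (((hslope m p).pow 2).const_mul (cm * cp))).add (((hslope n p).pow 2).const_mul (cn * cp))
  have h := ge_of_tendsto (b := 0) hlim ?_
  · linarith
  · filter_upwards [Ioo_mem_nhdsLT (zero_lt_one' ℝ)] with b hb
    have h := mul_nonneg (sq_nonneg (b - 1)⁻¹)
      (hD 1 ⟨zero_le_one, le_rfl⟩ b ⟨hb.1.le, hb.2.le⟩)
    simp only [one_pow, one_mul] at h
    linarith

theorem trinomial_posSemidef_of_coeff {m n p : ℕ} (hmn : m < n) (hnp : n < p)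
    {cm cn cp : ℝ} (hm : 0 < cm) (hn : 0 < cn)
    (hp : -(cm * cn * ((n : ℝ) - (m : ℝ)) ^ 2)
      / (cm * ((p : ℝ) - (m : ℝ)) ^ 2 + cn * ((p : ℝ) - (n : ℝ)) ^ 2) ≤ cp)
    (A : Matrix (Fin 2) (Fin 2) ℝ) (hA : A.PosSemidef) (hI : ∀ i j, A i j ∈ Set.Icc (0 : ℝ) 1) :
    (A.map fun x => cm * x ^ m + cn * x ^ n + cp * x ^ p).PosSemidef := by
  have hnm : (0 : ℝ) < n - m := sub_pos.2 (by exact_mod_cast hmn)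
  have hpn : (0 : ℝ) < p - n := sub_pos.2 (by exact_mod_cast hnp)
  have hpm : (0 : ℝ) < p - m := by linarith
  rw [div_le_iff₀ (by positivity)] at hp
  have hD : ∀ a ∈ Set.Icc (0 : ℝ) 1, ∀ b ∈ Set.Icc (0 : ℝ) 1,
      0 ≤ cm * cn * (a ^ m * b ^ n - a ^ n * b ^ m) ^ 2 +
        cm * cp * (a ^ m * b ^ p - a ^ p * b ^ m) ^ 2 +
        cn * cp * (a ^ n * b ^ p - a ^ p * b ^ n) ^ 2 := by
    intro a ha b hb
    rcases le_total 0 cp with hc | hc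
    · positivity
    · obtain ⟨h1, h2⟩ := mul_pow_sub_sq_le hmn hnp ha hb
      refine nonneg_of_mul_nonneg_right (a := ((n : ℝ) - m) ^ 2) ?_ (by positivity)
      have e1 := mul_le_mul_of_nonneg_left h1 (mul_nonneg hm.le (neg_nonneg.2 hc))
      have e2 := mul_le_mul_of_nonneg_left h2 (mul_nonneg hn.le (neg_nonneg.2 hc))
      have e3 := mul_le_mul_of_nonneg_right hp (sq_nonneg (a ^ m * b ^ n - a ^ n * b ^ m))
      linarith
  have hcpn : -cp * p ≤ cn * n := by
    rcases le_total 0 cp with hc | hc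
    · have : 0 ≤ cp * p := by positivity
      have : 0 ≤ cn * n := by positivity
      linarith
    · have h1 : -cp * (p - m) ^ 2 ≤ cn * (n - m) ^ 2 := by
        refine le_of_mul_le_mul_left ?_ hm
        have : 0 ≤ -cp * (cn * ((p : ℝ) - n) ^ 2) :=
          mul_nonneg (neg_nonneg.2 hc) (by positivity)
        linarith
      have h2 : ((n : ℝ) - m) ^ 2 * p ≤ n * (p - m) ^ 2 := by
        have h3 : 0 ≤ m * (((p : ℝ) - m) + (n - m)) * (p - n) := by positivity
        have h4 : 0 ≤ ((n : ℝ) - m) * (p - m) * (p - n) := by positivity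
        linarith
      refine le_of_mul_le_mul_right ?_ (pow_pos hpm 2)
      have h3 := mul_le_mul_of_nonneg_left h2 hn.le
      have h4 := mul_le_mul_of_nonneg_right h1 (Nat.cast_nonneg (α := ℝ) p)
      linarith
  have hmono : MonotoneOn (fun x : ℝ => cm * x ^ m + cn * x ^ n + cp * x ^ p) (Set.Icc 0 1) := by
    intro y hy x hx hyx
    have h1 := pow_le_pow_left₀ hy.1 hyx m
    have h1' := mul_le_mul_of_nonneg_left h1 hm.le
    have h2 := pow_sub_pow_le_ratio hnp.le hy.1 hyx hx.2
    have h3 : 0 ≤ x ^ p - y ^ p := sub_nonneg.2 (pow_le_pow_left₀ hy.1 hyx p)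
    have hp0 : (0 : ℝ) < p := by exact_mod_cast (Nat.zero_le n).trans_lt hnp
    have h4 : 0 ≤ cn * (x ^ n - y ^ n) + cp * (x ^ p - y ^ p) := by
      refine nonneg_of_mul_nonneg_right (a := (p : ℝ)) ?_ hp0
      have e1 := mul_le_mul_of_nonneg_left h2 hn.le
      have e2 := mul_le_mul_of_nonneg_right hcpn h3
      linarith
    simp only
    linarith
  have hn0 : n ≠ 0 := (Nat.zero_le m).trans_lt hmn |>.ne'
  have hp0 : p ≠ 0 := (Nat.zero_le n).trans_lt hnp |>.ne'
  have hf : ∀ x ∈ Set.Icc (0 : ℝ) 1, 0 ≤ cm * x ^ m + cn * x ^ n + cp * x ^ p := by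
    intro x hx
    refine le_trans ?_ (hmono ⟨le_rfl, zero_le_one⟩ hx hx.1)
    simp only [zero_pow hn0, zero_pow hp0, mul_zero, add_zero]
    positivity
  rw [posSemidef_fin_two_iff] at hA ⊢
  obtain ⟨h1, -, -, h4⟩ := hA
  simp only [Matrix.map_apply]
  refine ⟨by rw [h1], hf _ (hI _ _), hf _ (hI _ _), ?_⟩
  have hs : ∀ x ∈ Set.Icc (0 : ℝ) 1, √x ∈ Set.Icc (0 : ℝ) 1 := fun x hx =>
    ⟨Real.sqrt_nonneg x, Real.sqrt_le_one.2 hx.2⟩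
  have hx := hs _ (hI 0 0)
  have hy := hs _ (hI 1 1)
  have hd := det_trinomial m n p cm cn cp √(A 0 0) √(A 1 1)
  rw [Real.mul_self_sqrt (hI 0 0).1, Real.mul_self_sqrt (hI 1 1).1] at hd
  have hle : A 0 1 ≤ √(A 0 0) * √(A 1 1) := by
    rw [← Real.sqrt_mul (hI 0 0).1]
    exact Real.le_sqrt_of_sq_le h4
  have h5 := hmono (hI 0 1) ⟨mul_nonneg hx.1 hy.1, mul_le_one₀ hx.2 hy.1 hy.2⟩ hle
  have h6 := pow_le_pow_left₀ (hf _ (hI 0 1)) h5 2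
  simp only at h6
  linarith [hD _ hx _ hy]

theorem stmt_13 (m n p : ℕ) (hmn : m < n) (hnp : n < p)
    (cm cn cp : ℝ) (hcm : cm ≠ 0) (hcn : cn ≠ 0) :
    ((∀ A : Matrix (Fin 2) (Fin 2) ℝ, A.PosSemidef →
        (∀ i j, A i j ∈ Set.Icc (0 : ℝ) 1) →
        (A.map fun x => cm * x ^ m + cn * x ^ n + cp * x ^ p).PosSemidef)
      ↔ (∀ A : Matrix (Fin 2) (Fin 2) ℝ, A.PosSemidef → A.rank ≤ 1 →
        (∀ i j, A i j ∈ Set.Icc (0 : ℝ) 1) →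
        (A.map fun x => cm * x ^ m + cn * x ^ n + cp * x ^ p).PosSemidef))
    ∧ ((∀ A : Matrix (Fin 2) (Fin 2) ℝ, A.PosSemidef →
        (∀ i j, A i j ∈ Set.Icc (0 : ℝ) 1) →
        (A.map fun x => cm * x ^ m + cn * x ^ n + cp * x ^ p).PosSemidef)
      ↔ (0 < cm ∧ 0 < cn ∧
          -(cm * cn * ((n : ℝ) - (m : ℝ)) ^ 2)
              / (cm * ((p : ℝ) - (m : ℝ)) ^ 2 + cn * ((p : ℝ) - (n : ℝ)) ^ 2) ≤ cp)) := by
  have h23 (h : ∀ A : Matrix (Fin 2) (Fin 2) ℝ, A.PosSemidef → A.rank ≤ 1 →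
        (∀ i j, A i j ∈ Set.Icc (0 : ℝ) 1) →
        (A.map fun x => cm * x ^ m + cn * x ^ n + cp * x ^ p).PosSemidef) :
      0 < cm ∧ 0 < cn ∧ -(cm * cn * ((n : ℝ) - (m : ℝ)) ^ 2)
        / (cm * ((p : ℝ) - (m : ℝ)) ^ 2 + cn * ((p : ℝ) - (n : ℝ)) ^ 2) ≤ cp := by
    have key : ∀ a ∈ Set.Icc (0 : ℝ) 1, ∀ b ∈ Set.Icc (0 : ℝ) 1,
        0 ≤ cm * (a * a) ^ m + cn * (a * a) ^ n + cp * (a * a) ^ p ∧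
        0 ≤ (cm * (a * a) ^ m + cn * (a * a) ^ n + cp * (a * a) ^ p) *
          (cm * (b * b) ^ m + cn * (b * b) ^ n + cp * (b * b) ^ p) -
          (cm * (a * b) ^ m + cn * (a * b) ^ n + cp * (a * b) ^ p) ^ 2 := by
      intro a ha b hb
      have hpsd := h (Matrix.vecMulVec ![a, b] ![a, b])
        ((posSemidef_fin_two_iff _).2 (by
          simp only [Matrix.vecMulVec_apply, Matrix.cons_val_zero, Matrix.cons_val_one]
          exact ⟨mul_comm _ _, mul_self_nonneg a, mul_self_nonneg b, by linarith⟩))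
        (Matrix.rank_vecMulVec_le _ _)
        (by
          have hab : ∀ i, ![a, b] i ∈ Set.Icc (0 : ℝ) 1 := by
            intro i; fin_cases i
            · exact ha
            · exact hb
          intro i j
          rw [Matrix.vecMulVec_apply]
          exact ⟨mul_nonneg (hab i).1 (hab j).1, mul_le_one₀ (hab i).2 (hab j).1 (hab j).2⟩)
      rw [posSemidef_fin_two_iff] at hpsd
      simp only [Matrix.map_apply, Matrix.vecMulVec_apply, Matrix.cons_val_zero,
        Matrix.cons_val_one] at hpsd
      exact ⟨hpsd.2.1, sub_nonneg.2 hpsd.2.2.2⟩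
    refine trinomial_coeff_of_rank_one hmn hnp hcm hcn ?_ ?_
    · intro x hx
      have hs : √x ∈ Set.Icc (0 : ℝ) 1 := ⟨Real.sqrt_nonneg x, Real.sqrt_le_one.2 hx.2⟩
      simpa only [Real.mul_self_sqrt hx.1] using (key _ hs _ hs).1
    · intro a ha b hb
      rw [← det_trinomial]
      exact (key a ha b hb).2
  have h31 (h : 0 < cm ∧ 0 < cn ∧ -(cm * cn * ((n : ℝ) - (m : ℝ)) ^ 2)
        / (cm * ((p : ℝ) - (m : ℝ)) ^ 2 + cn * ((p : ℝ) - (n : ℝ)) ^ 2) ≤ cp) :=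
    trinomial_posSemidef_of_coeff hmn hnp h.1 h.2.1 h.2.2
  exact ⟨⟨fun h A hA _ => h A hA, fun h => h31 (h23 h)⟩, fun h => h23 fun A hA _ => h A hA, h31⟩
end

section
/- Fix integers N ≥ 1 and M ≥ 0, positive reals c_0, …, c_{N−1}, and a nonzero matrix A ∈ 𝒫_N(ℂ). Then ker(c_0·1_{N×N} + c_1 A + ⋯ + c_{N−1} A^{∘(N−1)}) ⊆ ker A^{∘M}, and there exists a finite smallest constant C ≥ 0 (the extreme critical value 𝒞(c; z^M; A)) such that A^{∘M} ≤ C · (c_0·1_{N×N} + c_1 A + ⋯ + c_{N−1} A^{∘(N−1)}) in the Loewner order; equivalently, v* A^{∘M} v ≤ C · v*(Σ_{j=0}^{N−1} c_j A^{∘j})v for all v ∈ ℂ^N. -/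
open scoped ComplexOrder Matrix

noncomputable section

/-- The `k`-th Hadamard (entrywise) power of a matrix. -/
def hadPow {N : ℕ} (A : Matrix (Fin N) (Fin N) ℂ) (k : ℕ) : Matrix (Fin N) (Fin N) ℂ :=
  Matrix.of fun i j => A i j ^ k

section Loewner

open scoped MatrixOrder Matrix.Norms.L2Operator

variable {n : Type*} [Fintype n] [DecidableEq n]

/-- A positive semidefinite matrix whose kernel contains that of another one is dominated by a
multiple of it in the Loewner order. -/
theorem Matrix.PosSemidef.exists_le_smul_of_ker_le {B H : Matrix n n ℂ} (hB : B.PosSemidef)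
    (hH : H.PosSemidef) (hker : ∀ v, B *ᵥ v = 0 → H *ᵥ v = 0) :
    ∃ C : ℝ, H ≤ (C : ℂ) • B := by
  obtain ⟨D, rfl⟩ := CStarAlgebra.nonneg_iff_eq_star_mul_self.mp hB.nonneg
  obtain ⟨E, rfl⟩ := CStarAlgebra.nonneg_iff_eq_star_mul_self.mp hH.nonneg
  simp only [Matrix.star_eq_conjTranspose, Matrix.conjTranspose_mul_self_mulVec_eq_zero] at hker
  obtain ⟨g, hg⟩ := (Matrix.toLin' D).rangeRestrict.exists_rightInverse_of_surjective
    (LinearMap.range_rangeRestrict _)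
  obtain ⟨f, hf⟩ := (Matrix.toLin' E ∘ₗ g).exists_extend
  obtain ⟨X, rfl⟩ := Matrix.toLin'.surjective f
  have hXD : X * D = E := by
    apply Matrix.toLin'.injective
    refine LinearMap.ext fun v => ?_
    have h1 := LinearMap.congr_fun hf ((Matrix.toLin' D).rangeRestrict v)
    have h2 := congrArg Subtype.val (LinearMap.congr_fun hg ((Matrix.toLin' D).rangeRestrict v))
    have h3 := hker (g ((Matrix.toLin' D).rangeRestrict v) - v)
      (by simpa [Matrix.mulVec_sub, sub_eq_zero] using h2)
    rw [Matrix.mulVec_sub, sub_eq_zero] at h3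
    simpa [h3] using h1
  refine ⟨‖star X * X‖, ?_⟩
  have hX : star X * X ≤ algebraMap ℝ _ ‖star X * X‖ := IsSelfAdjoint.le_algebraMap_norm_self
  have := star_left_conjugate_le_conjugate hX D
  rw [Algebra.algebraMap_eq_smul_one] at this
  simpa [← hXD, mul_assoc] using this

/-- If `ker B ⊆ ker H` and `B` has a positive diagonal entry, then there is a least real `C` with
`H ≤ C • B`, and it is nonnegative. -/
theorem Matrix.PosSemidef.exists_isLeast_le_smul {B H : Matrix n n ℂ} (hB : B.PosSemidef)
    (hH : H.PosSemidef) (hker : ∀ v, B *ᵥ v = 0 → H *ᵥ v = 0) {i : n} (hi : 0 < B i i) :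
    ∃ C : ℝ, 0 ≤ C ∧ IsLeast {C : ℝ | H ≤ (C : ℂ) • B} C := by
  have hnonneg : ∀ C ∈ {C : ℝ | H ≤ (C : ℂ) • B}, 0 ≤ C := by
    intro C hC
    have h1 : 0 ≤ (C : ℂ) * B i i :=
      (Matrix.nonneg_iff_posSemidef.mp (hH.nonneg.trans hC)).diag_nonneg
    have h2 := (Complex.nonneg_iff.mp h1).1
    rw [Complex.re_ofReal_mul] at h2
    exact nonneg_of_mul_nonneg_left h2 (Complex.pos_iff.mp hi).1
  have hclosed : IsClosed {C : ℝ | H ≤ (C : ℂ) • B} :=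
    isClosed_le continuous_const (by fun_prop)
  have hleast := hclosed.isLeast_csInf (hB.exists_le_smul_of_ker_le hH hker) ⟨0, hnonneg⟩
  exact ⟨_, hnonneg _ hleast.1, hleast⟩

end Loewner

open Polynomial in
/-- If the power sums `∑ k, a k ^ j * v k` vanish for all `j` below the number of nodes, then they
all vanish. -/
theorem sum_pow_mul_eq_zero_of_lt_card {R ι : Type*} [CommRing R] [Fintype ι] {a v : ι → R}
    (h : ∀ j < Fintype.card ι, ∑ k, a k ^ j * v k = 0) (m : ℕ) : ∑ k, a k ^ m * v k = 0 := by
  nontriviality R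
  cases isEmpty_or_nonempty ι
  · simp
  set q : R[X] := ∏ k, (X - C (a k)) with hq
  have hmonic : q.Monic := monic_prod_of_monic _ _ fun k _ => monic_X_sub_C _
  have hdeg : q.natDegree = Fintype.card ι := by simp [hq]
  set p := (X ^ m : R[X]) %ₘ q with hp
  have hpdeg : p.natDegree < Fintype.card ι := by
    refine hdeg ▸ natDegree_modByMonic_lt _ hmonic fun hq1 => ?_
    rw [hq1, natDegree_one] at hdeg
    exact Fintype.card_ne_zero hdeg.symm
  have heval (k : ι) : a k ^ m = ∑ j ∈ Finset.range (Fintype.card ι), p.coeff j * a k ^ j := by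
    have hqk : q.eval (a k) = 0 := by
      rw [hq, eval_prod]
      exact Finset.prod_eq_zero (Finset.mem_univ k) (by simp)
    have h1 := congrArg (eval (a k)) (modByMonic_add_div (X ^ m : R[X]) q)
    rw [eval_add, eval_mul, hqk, zero_mul, add_zero, eval_pow, eval_X, ← hp] at h1
    rw [← h1, eval_eq_sum_range' hpdeg]
  simp_rw [heval, Finset.sum_mul]
  rw [Finset.sum_comm]
  refine Finset.sum_eq_zero fun j hj => ?_
  simp_rw [mul_assoc]
  rw [← Finset.mul_sum, h j (Finset.mem_range.mp hj), mul_zero]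

theorem hadPow_posSemidef {N : ℕ} {A : Matrix (Fin N) (Fin N) ℂ} (hA : A.PosSemidef) (k : ℕ) :
    (hadPow A k).PosSemidef := by
  induction k with
  | zero =>
    convert Matrix.posSemidef_vecMulVec_self_star (1 : Fin N → ℂ) using 1
    ext i j
    simp [hadPow, Matrix.vecMulVec_apply]
  | succ k ih =>
    have hsucc : hadPow A (k + 1) = hadPow A k ⊙ A := by
      ext i j
      simp [hadPow, pow_succ]
    rw [hsucc]
    exact ih.hadamard hA

theorem stmt_14 (N M : ℕ) (hN : 1 ≤ N) (c : Fin N → ℝ) (hc : ∀ j, 0 < c j)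
    (A : Matrix (Fin N) (Fin N) ℂ) (hA : A.PosSemidef) (hA0 : A ≠ 0) :
    (∀ v : Fin N → ℂ, (∑ j : Fin N, (c j : ℂ) • hadPow A (j : ℕ)) *ᵥ v = 0 →
      hadPow A M *ᵥ v = 0)
    ∧ ∃ C : ℝ, 0 ≤ C ∧
        ((C : ℂ) • ∑ j : Fin N, (c j : ℂ) • hadPow A (j : ℕ) - hadPow A M).PosSemidef ∧
        ∀ C' : ℝ,
          ((C' : ℂ) • ∑ j : Fin N, (c j : ℂ) • hadPow A (j : ℕ) - hadPow A M).PosSemidef →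
          C ≤ C' := by
  have hcC (j : Fin N) : (0 : ℂ) < c j := by exact_mod_cast hc j
  have hterm (j : Fin N) : ((c j : ℂ) • hadPow A (j : ℕ)).PosSemidef :=
    (hadPow_posSemidef hA j).smul (hcC j).le
  set B := ∑ j : Fin N, (c j : ℂ) • hadPow A (j : ℕ) with hBdef
  have hB : B.PosSemidef := Matrix.posSemidef_sum _ fun j _ => hterm j
  have hker (v : Fin N → ℂ) (hv : B *ᵥ v = 0) : hadPow A M *ᵥ v = 0 := by
    have hpow (j : Fin N) : hadPow A (j : ℕ) *ᵥ v = 0 := by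
      have h1 := (hB.dotProduct_mulVec_zero_iff v).mpr hv
      rw [hBdef, Matrix.sum_mulVec, dotProduct_sum,
        Finset.sum_eq_zero_iff_of_nonneg fun j _ => (hterm j).dotProduct_mulVec_nonneg v] at h1
      have h2 := ((hterm j).dotProduct_mulVec_zero_iff v).mp (h1 j (Finset.mem_univ j))
      rw [Matrix.smul_mulVec] at h2
      exact (smul_eq_zero.mp h2).resolve_left (hcC j).ne'
    ext i
    refine sum_pow_mul_eq_zero_of_lt_card (a := A i) (v := v) (fun j hj => ?_) M
    exact congrFun (hpow ⟨j, by simpa using hj⟩) i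
  refine ⟨hker, ?_⟩
  have hdiag : 0 < B ⟨0, hN⟩ ⟨0, hN⟩ := by
    rw [hBdef, Matrix.sum_apply]
    exact Finset.sum_pos' (fun j _ => (hterm j).diag_nonneg)
      ⟨⟨0, hN⟩, Finset.mem_univ _, by simpa [hadPow] using hc ⟨0, hN⟩⟩
  obtain ⟨C, hC0, hC, hmin⟩ :=
    hB.exists_isLeast_le_smul (hadPow_posSemidef hA M) hker hdiag
  exact ⟨C, hC0, hC, fun C' hC' => hmin hC'⟩
end
end

section
/- Fix integers m ≥ N ≥ 1 and M ≥ 0, and matrices A, B ∈ 𝒫_N(ℂ). Then ker(B ∘ Σ_{j=0}^{m−1} A^{∘j}) ⊆ ker(B ∘ A^{∘M}), where ∘ denotes the entrywise (Hadamard) product of matrices. -/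
open scoped ComplexOrder Matrix

noncomputable section

/-- Hadamard powers of a positive semidefinite matrix, multiplied entrywise by a positive
semidefinite matrix, are positive semidefinite. -/
theorem Matrix.PosSemidef.hadamard_pow {ι : Type*} [Fintype ι] {A B : Matrix ι ι ℂ}
    (hA : A.PosSemidef) (hB : B.PosSemidef) (k : ℕ) :
    (Matrix.of fun i j => B i j * A i j ^ k).PosSemidef := by
  induction k with
  | zero =>
    simp only [pow_zero, mul_one]
    exact hB
  | succ k ih =>
    have hmul : (Matrix.of fun i j => B i j * A i j ^ (k + 1)) =
        (Matrix.of fun i j => B i j * A i j ^ k) ⊙ A := by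
      ext i j
      simp [pow_succ, mul_assoc]
    rw [hmul]
    exact ih.hadamard hA

/-- A vector in the kernel of a sum of positive semidefinite matrices is in the kernel of each
summand. -/
theorem Matrix.PosSemidef.mulVec_eq_zero_of_sum_mulVec_eq_zero {ι κ : Type*} [Fintype ι]
    {s : Finset κ} {P : κ → Matrix ι ι ℂ} (hP : ∀ k ∈ s, (P k).PosSemidef) {v : ι → ℂ}
    (hv : (∑ k ∈ s, P k) *ᵥ v = 0) {k : κ} (hk : k ∈ s) : P k *ᵥ v = 0 := by
  have hsum : ∑ k ∈ s, star v ⬝ᵥ (P k *ᵥ v) = 0 := by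
    rw [← dotProduct_sum, ← Matrix.sum_mulVec, hv, dotProduct_zero]
  rw [← (hP k hk).dotProduct_mulVec_zero_iff]
  exact (Finset.sum_eq_zero_iff_of_nonneg
    fun k hk => (hP k hk).dotProduct_mulVec_nonneg v).1 hsum k hk

open Polynomial in
/-- If a linear combination of point evaluations at `a j` kills the monomials of degree less than
the number of nodes, then it kills every monomial. -/
theorem sum_mul_pow_eq_zero_of_lt_card {ι R : Type*} [Fintype ι] [CommRing R]
    {w a : ι → R} (h : ∀ k < Fintype.card ι, ∑ j, w j * a j ^ k = 0) (M : ℕ) :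
    ∑ j, w j * a j ^ M = 0 := by
  nontriviality R
  set q : R[X] := ∏ j, (X - C (a j))
  have hq : q.Monic := monic_prod_of_monic _ _ fun j _ => monic_X_sub_C (a j)
  have hdeg : (X ^ M %ₘ q).degree < (Fintype.card ι : WithBot ℕ) := by
    have hcard : q.degree = Fintype.card ι := by
      rw [degree_eq_natDegree hq.ne_zero, natDegree_finsetProd_X_sub_C_eq_card]
      rfl
    exact hcard ▸ degree_modByMonic_lt _ hq
  have heval (j : ι) : a j ^ M =
      ∑ k : Fin (Fintype.card ι), (X ^ M %ₘ q).coeff k * a j ^ (k : ℕ) := by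
    have hroot : q.IsRoot (a j) :=
      dvd_iff_isRoot.1 (Finset.dvd_prod_of_mem (fun j => X - C (a j)) (Finset.mem_univ j))
    calc a j ^ M = (X ^ M %ₘ q).eval (a j) := by
          conv_lhs => rw [← eval_X_pow, ← modByMonic_add_div (X ^ M) q]
          simp [hroot.eq_zero]
      _ = _ := by
          rw [eval_eq_sum, ← sum_fin _ (by simp) hdeg]
  simp_rw [heval, Finset.mul_sum]
  rw [Finset.sum_comm]
  refine Finset.sum_eq_zero fun k _ => ?_
  simp_rw [mul_left_comm (w _)]
  rw [← Finset.mul_sum, h k k.isLt, mul_zero]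

theorem stmt_16 (N m M : ℕ) (hN : 1 ≤ N) (hm : N ≤ m)
    (A B : Matrix (Fin N) (Fin N) ℂ) (hA : A.PosSemidef) (hB : B.PosSemidef)
    (v : Fin N → ℂ)
    (hv : (Matrix.of fun i j => B i j * ∑ k ∈ Finset.range m, A i j ^ k) *ᵥ v = 0) :
    (Matrix.of fun i j => B i j * A i j ^ M) *ᵥ v = 0 := by
  have hsum : (∑ k ∈ Finset.range m, Matrix.of fun i j => B i j * A i j ^ k) *ᵥ v = 0 := by
    convert hv using 2
    ext i j
    simp [Matrix.sum_apply, Finset.mul_sum]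
  ext i
  have hrow (k : ℕ) : ((Matrix.of fun i j => B i j * A i j ^ k) *ᵥ v) i =
      ∑ j, B i j * v j * A i j ^ k := by
    simp [Matrix.mulVec, dotProduct, mul_right_comm]
  rw [hrow]
  refine sum_mul_pow_eq_zero_of_lt_card (fun k hk => ?_) M
  rw [Fintype.card_fin] at hk
  rw [← hrow, Matrix.PosSemidef.mulVec_eq_zero_of_sum_mulVec_eq_zero
    (fun k _ => hA.hadamard_pow hB k) hsum (Finset.mem_range.2 (hk.trans_le hm)), Pi.zero_apply]
end
end

section
/- Fix integers N ≥ 1 and M ≥ 0 and positive reals c_0, …, c_{N−1}, and let u ∈ ℂ^N be nonzero. Let H := Σ_{j=0}^{N−1} c_j u^{∘j} (u^{∘j})*, where u^{∘j} denotes the entrywise j-th power of u. Then the smallest constant C ≥ 0 such that (uu*)^{∘M} ≤ C·H in the Loewner order equals (u^{∘M})* H† u^{∘M}, where H† is the Moore–Penrose pseudoinverse of H (the unique matrix X with HXH = H, XHX = X, and HX, XH Hermitian). In particular, for u = √ρ·(1,…,1)* with ρ > 0, this constant equals ρ^M / (Σ_{j=0}^{N−1} c_j ρ^j), which is at most 𝒞(c;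 z^M; N, ρ), with equality if and only if N = 1 (assuming M ≥ N when N > 1). -/
open scoped ComplexOrder Matrix

noncomputable section

/-- The constant `𝒞(c; z^M; N, ρ)`. -/
def CC (N : ℕ) (c : Fin N → ℝ) (M : ℕ) (ρ : ℝ) : ℝ :=
  ∑ j : Fin N, (M.choose j : ℝ) ^ 2 * ((M - (j : ℕ) - 1).choose (N - (j : ℕ) - 1) : ℝ) ^ 2
    * ρ ^ (M - (j : ℕ)) / c j

/-- The entrywise `k`-th power of a vector. -/
def uPow {N : ℕ} (u : Fin N → ℂ) (k : ℕ) : Fin N → ℂ := fun i => u i ^ k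

/-- The matrix `H = Σ_j c_j u^{∘j} (u^{∘j})^*`. -/
def Hc {N : ℕ} (c : Fin N → ℝ) (u : Fin N → ℂ) : Matrix (Fin N) (Fin N) ℂ :=
  ∑ j : Fin N, (c j : ℂ) • Matrix.vecMulVec (uPow u (j : ℕ)) (star (uPow u (j : ℕ)))

/-- `X` is the Moore–Penrose pseudoinverse of `H`. -/
def IsMP {N : ℕ} (H X : Matrix (Fin N) (Fin N) ℂ) : Prop :=
  H * X * H = H ∧ X * H * X = X ∧ (H * X).IsHermitian ∧ (X * H).IsHermitian

open Matrix Polynomial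

/-- The quadratic form of `C • H - v v^*`. -/
theorem star_dotProduct_smul_sub_vecMulVec_mulVec {n : Type*} [Fintype n] (H : Matrix n n ℂ)
    (v w : n → ℂ) (C : ℂ) :
    star w ⬝ᵥ (C • H - vecMulVec v (star v)) *ᵥ w
      = C * (star w ⬝ᵥ H *ᵥ w) - star (star v ⬝ᵥ w) * (star v ⬝ᵥ w) := by
  have h : star (star v ⬝ᵥ w) = star w ⬝ᵥ v := (star_dotProduct w v).symm
  rw [h, sub_mulVec, smul_mulVec, vecMulVec_mulVec, dotProduct_sub, dotProduct_smul,
    dotProduct_smul, smul_eq_mul, op_smul_eq_smul, smul_eq_mul]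
  ring

/-- If `v = H x` is nonzero and `H` is positive semidefinite, then `x^* H x` is the least `C` such
that `v v^* ≤ C H`. -/
theorem isLeast_smul_sub_vecMulVec_posSemidef {n : Type*} [Fintype n] {H : Matrix n n ℂ}
    (hH : H.PosSemidef) {v x : n → ℂ} (hv : H *ᵥ x = v) (hv0 : v ≠ 0) :
    IsLeast {C : ℝ | ((C : ℂ) • H - vecMulVec v (star v)).PosSemidef}
      (star x ⬝ᵥ H *ᵥ x).re := by
  obtain ⟨k, hk⟩ : ∃ k : ℝ, star x ⬝ᵥ H *ᵥ x = (k : ℂ) :=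
    ⟨_, Complex.eq_re_of_ofReal_le (r := 0) (by simpa using hH.dotProduct_mulVec_nonneg x)⟩
  have hk0 : 0 < k := by
    have h0 : (0 : ℂ) ≤ k := hk ▸ hH.dotProduct_mulVec_nonneg x
    refine lt_of_le_of_ne (by exact_mod_cast h0) fun h => hv0 ?_
    rw [← hv, ← hH.dotProduct_mulVec_zero_iff, hk, ← h, Complex.ofReal_zero]
  have hkC : (k : ℂ) ≠ 0 := by exact_mod_cast hk0.ne'
  have hleft (w : n → ℂ) : star x ⬝ᵥ H *ᵥ w = star v ⬝ᵥ w := by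
    rw [← hv, star_mulVec, hH.isHermitian.eq, dotProduct_mulVec]
  rw [hk, Complex.ofReal_re]
  constructor
  · refine .of_dotProduct_mulVec_nonneg ?_ fun w => ?_
    · refine IsHermitian.sub ?_ (posSemidef_vecMulVec_self_star v).isHermitian
      exact (hH.smul (by exact_mod_cast hk0.le : (0 : ℂ) ≤ k)).isHermitian
    · rw [star_dotProduct_smul_sub_vecMulVec_mulVec]
      set a := star v ⬝ᵥ w with ha
      have hright : star w ⬝ᵥ v = star a := star_dotProduct w v
      have hy := hH.dotProduct_mulVec_nonneg (w - (a / k) • x)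
      have hexp : star (w - (a / k) • x) ⬝ᵥ H *ᵥ (w - (a / k) • x)
          = star w ⬝ᵥ H *ᵥ w - star a * a / k := by
        rw [mulVec_sub, mulVec_smul, star_sub, star_smul, sub_dotProduct, dotProduct_sub,
          dotProduct_sub, smul_dotProduct, smul_dotProduct, dotProduct_smul, dotProduct_smul, hk,
          hleft, hv, hright, ← ha]
        simp only [smul_eq_mul, star_div₀, Complex.star_def, Complex.conj_ofReal]
        field_simp
        ring
      rw [hexp] at hy
      have := mul_nonneg (by exact_mod_cast hk0.le : (0 : ℂ) ≤ k) hy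
      rwa [mul_sub, mul_div_cancel₀ _ hkC] at this
  · intro C hC
    have h := hC.dotProduct_mulVec_nonneg x
    have hvx : star v ⬝ᵥ x = k := by rw [← hleft, hk]
    rw [star_dotProduct_smul_sub_vecMulVec_mulVec, hk, hvx, Complex.star_def,
      Complex.conj_ofReal] at h
    have h' : 0 ≤ C * k - k * k := by exact_mod_cast h
    nlinarith

/-- A vector orthogonal to the kernel of a Hermitian matrix is fixed by `H * X` for every
Moore–Penrose pseudoinverse `X`. -/
theorem IsMP.mulVec_mulVec_eq {N : ℕ} {H X : Matrix (Fin N) (Fin N) ℂ} (hX : IsMP H X)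
    (hH : H.IsHermitian) {v : Fin N → ℂ} (hv : ∀ w, H *ᵥ w = 0 → star v ⬝ᵥ w = 0) :
    H *ᵥ X *ᵥ v = v := by
  obtain ⟨h1, -, h3, -⟩ := hX
  have hHP : H * (H * X) = H := by
    have := congrArg conjTranspose h1
    rwa [conjTranspose_mul, hH.eq, h3.eq] at this
  have horth (w : Fin N → ℂ) : star v ⬝ᵥ (H * X) *ᵥ w = star v ⬝ᵥ w := by
    have := hv (w - (H * X) *ᵥ w) (by rw [mulVec_sub, mulVec_mulVec, hHP, sub_self])
    rw [dotProduct_sub, sub_eq_zero] at this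
    exact this.symm
  have : star v ᵥ* (H * X) = star v := by
    refine dotProduct_eq _ _ fun w => ?_
    rw [← dotProduct_mulVec, horth]
  rw [mulVec_mulVec, ← star_inj, star_mulVec, h3.eq, this]

theorem Hc_posSemidef {N : ℕ} {c : Fin N → ℝ} (hc : ∀ j, 0 < c j) (u : Fin N → ℂ) :
    (Hc c u).PosSemidef :=
  posSemidef_sum _ fun j _ => (posSemidef_vecMulVec_self_star _).smul
    (by exact_mod_cast (hc j).le : (0 : ℂ) ≤ c j)

theorem uPow_dotProduct_eq_zero_of_Hc_mulVec_eq_zero {N : ℕ} {c : Fin N → ℝ}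
    (hc : ∀ j, 0 < c j) {u w : Fin N → ℂ} (h : Hc c u *ᵥ w = 0) (j : Fin N) :
    star (uPow u j) ⬝ᵥ w = 0 := by
  have hsum : ∑ j : Fin N, c j * Complex.normSq (star (uPow u j) ⬝ᵥ w) = 0 := by
    have h0 : star w ⬝ᵥ Hc c u *ᵥ w = 0 := by rw [h, dotProduct_zero]
    rw [Hc, sum_mulVec, dotProduct_sum] at h0
    rw [← Complex.ofReal_inj, Complex.ofReal_sum, Complex.ofReal_zero, ← h0]
    refine Finset.sum_congr rfl fun j _ => ?_
    rw [smul_mulVec, vecMulVec_mulVec, dotProduct_smul, dotProduct_smul, op_smul_eq_smul,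
      smul_eq_mul, smul_eq_mul, Complex.ofReal_mul, Complex.normSq_eq_conj_mul_self,
      ← Complex.star_def, ← star_dotProduct, mul_comm (star w ⬝ᵥ _)]
  rw [Finset.sum_eq_zero_iff_of_nonneg
    fun j _ => mul_nonneg (hc j).le (Complex.normSq_nonneg _)] at hsum
  have := hsum j (Finset.mem_univ j)
  simpa [(hc j).ne'] using this

/-- Every entrywise power of `u ∈ ℂ^N` is a combination of the first `N` of them. -/
theorem exists_uPow_eq_sum {N : ℕ} (u : Fin N → ℂ) (M : ℕ) :
    ∃ a : Fin N → ℂ, uPow u M = ∑ j : Fin N, a j • uPow u j := by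
  obtain rfl | hN := N.eq_zero_or_pos
  · exact ⟨0, Subsingleton.elim _ _⟩
  set q : ℂ[X] := ∏ i : Fin N, (X - C (u i)) with hq
  have hqm : q.Monic := monic_prod_of_monic _ _ fun i _ => monic_X_sub_C _
  have hdeg : q.natDegree = N := by
    rw [hq, natDegree_prod_of_monic _ _ fun i _ => monic_X_sub_C _]
    simp
  have hlt : ((X : ℂ[X]) ^ M %ₘ q).natDegree < N := by
    refine hdeg ▸ natDegree_modByMonic_lt _ hqm fun h => ?_
    rw [h, natDegree_one] at hdeg
    exact hN.ne hdeg
  refine ⟨fun j => ((X : ℂ[X]) ^ M %ₘ q).coeff j, funext fun i => ?_⟩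
  have hroot : q.IsRoot (u i) := by
    rw [IsRoot, hq, eval_prod]
    exact Finset.prod_eq_zero (Finset.mem_univ i) (by simp)
  have heval : ((X : ℂ[X]) ^ M %ₘ q).eval (u i) = u i ^ M := by
    have := congrArg (eval (u i)) (modByMonic_add_div ((X : ℂ[X]) ^ M) q)
    rwa [eval_add, eval_mul, hroot.eq_zero, zero_mul, add_zero, eval_pow, eval_X] at this
  rw [eval_eq_sum_range' hlt, Finset.sum_range] at heval
  simp [uPow, ← heval]

theorem uPow_ne_zero {N : ℕ} {u : Fin N → ℂ} (hu : u ≠ 0) (M : ℕ) : uPow u M ≠ 0 := by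
  obtain ⟨i, hi⟩ := Function.ne_iff.mp hu
  exact Function.ne_iff.mpr ⟨i, pow_ne_zero M hi⟩

theorem isLeast_of_isMP {N : ℕ} (M : ℕ) {c : Fin N → ℝ} (hc : ∀ j, 0 < c j) {u : Fin N → ℂ}
    (hu : u ≠ 0) {X : Matrix (Fin N) (Fin N) ℂ} (hX : IsMP (Hc c u) X) :
    IsLeast {C : ℝ |
        ((C : ℂ) • Hc c u - vecMulVec (uPow u M) (star (uPow u M))).PosSemidef}
      (star (uPow u M) ⬝ᵥ X *ᵥ uPow u M).re := by
  have hH := Hc_posSemidef hc u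
  have hv : Hc c u *ᵥ X *ᵥ uPow u M = uPow u M := by
    refine hX.mulVec_mulVec_eq hH.isHermitian fun w hw => ?_
    obtain ⟨a, ha⟩ := exists_uPow_eq_sum u M
    rw [ha, star_sum, sum_dotProduct]
    refine Finset.sum_eq_zero fun j _ => ?_
    rw [star_smul, smul_dotProduct, uPow_dotProduct_eq_zero_of_Hc_mulVec_eq_zero hc hw,
      smul_zero]
  have hval : star (X *ᵥ uPow u M) ⬝ᵥ Hc c u *ᵥ X *ᵥ uPow u M
      = star (uPow u M) ⬝ᵥ X *ᵥ uPow u M := by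
    rw [dotProduct_mulVec]
    conv_lhs => rw [← hH.isHermitian.eq, ← star_mulVec, hv]
  exact hval ▸ isLeast_smul_sub_vecMulVec_posSemidef hH hv (uPow_ne_zero hu M)

theorem vecMulVec_uPow_const_sqrt (N M : ℕ) {ρ : ℝ} (hρ : 0 ≤ ρ) :
    vecMulVec (uPow (fun _ : Fin N => (√ρ : ℂ)) M) (star (uPow (fun _ : Fin N => (√ρ : ℂ)) M))
      = ((ρ ^ M : ℝ) : ℂ) • vecMulVec (1 : Fin N → ℂ) (star 1) := by
  ext i j
  simp only [vecMulVec_apply, uPow, Pi.star_apply, star_pow, Complex.star_def,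
    Complex.conj_ofReal, Matrix.smul_apply, Pi.one_apply, star_one, smul_eq_mul, mul_one]
  rw [← mul_pow, ← Complex.ofReal_mul, Real.mul_self_sqrt hρ, Complex.ofReal_pow]

theorem isLeast_const_sqrt {N : ℕ} (M : ℕ) (hN : 1 ≤ N) {c : Fin N → ℝ} (hc : ∀ j, 0 < c j)
    {ρ : ℝ} (hρ : 0 < ρ) :
    IsLeast {C : ℝ |
        ((C : ℂ) • Hc c (fun _ => (√ρ : ℂ))
          - vecMulVec (uPow (fun _ => (√ρ : ℂ)) M)
              (star (uPow (fun _ => (√ρ : ℂ)) M))).PosSemidef}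
      (ρ ^ M / ∑ j : Fin N, c j * ρ ^ (j : ℕ)) := by
  have : NeZero N := ⟨by lia⟩
  have hS : 0 < ∑ j : Fin N, c j * ρ ^ (j : ℕ) :=
    Finset.sum_pos (fun j _ => mul_pos (hc j) (pow_pos hρ _)) Finset.univ_nonempty
  have hmat (C : ℝ) : (C : ℂ) • Hc c (fun _ => (√ρ : ℂ))
        - vecMulVec (uPow (fun _ => (√ρ : ℂ)) M) (star (uPow (fun _ => (√ρ : ℂ)) M))
      = ((C * (∑ j : Fin N, c j * ρ ^ (j : ℕ)) - ρ ^ M : ℝ) : ℂ)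
          • vecMulVec (1 : Fin N → ℂ) (star 1) := by
    simp only [Hc, vecMulVec_uPow_const_sqrt _ _ hρ.le, smul_smul, ← Finset.sum_smul, ← sub_smul]
    push_cast
    rfl
  constructor
  · rw [Set.mem_ofPred_eq, hmat, div_mul_cancel₀ _ hS.ne', sub_self, Complex.ofReal_zero,
      zero_smul]
    exact .zero
  · intro C hC
    rw [Set.mem_ofPred_eq, hmat] at hC
    have h := hC.diag_nonneg (i := 0)
    simp only [Matrix.smul_apply, vecMulVec_apply, Pi.one_apply, star_one, smul_eq_mul,
      mul_one] at h
    rw [div_le_iff₀ hS]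
    exact sub_nonneg.mp (by exact_mod_cast h)

theorem CC_one (c : Fin 1 → ℝ) (M : ℕ) (ρ : ℝ) : CC 1 c M ρ = ρ ^ M / c 0 := by
  simp [_root_.CC]

theorem div_sum_lt_CC {N M : ℕ} (hN : 1 < N) (hMN : N ≤ M) {c : Fin N → ℝ}
    (hc : ∀ j, 0 < c j) {ρ : ℝ} (hρ : 0 < ρ) :
    ρ ^ M / (∑ j : Fin N, c j * ρ ^ (j : ℕ)) < CC N c M ρ := by
  let z : Fin N := ⟨0, by lia⟩
  have hS : c z < ∑ j : Fin N, c j * ρ ^ (j : ℕ) := by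
    have := Finset.single_lt_sum (f := fun j : Fin N => c j * ρ ^ (j : ℕ))
      (i := z) (j := ⟨1, hN⟩) (by simp [z]) (Finset.mem_univ _) (Finset.mem_univ _)
      (mul_pos (hc _) (pow_pos hρ _)) fun j _ _ => (mul_pos (hc j) (pow_pos hρ _)).le
    simpa [z] using this
  refine (div_lt_div_of_pos_left (pow_pos hρ M) (hc z) hS).trans_le ?_
  refine le_trans ?_ (Finset.single_le_sum (fun j _ => ?_) (Finset.mem_univ z))
  · have hch : (1 : ℝ) ≤ ((M - 1).choose (N - 1) : ℝ) := by
      exact_mod_cast Nat.choose_pos (by lia : N - 1 ≤ M - 1)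
    have : ρ ^ M ≤ ((M - 1).choose (N - 1) : ℝ) ^ 2 * ρ ^ M :=
      le_mul_of_one_le_left (pow_pos hρ M).le (one_le_pow₀ hch)
    simpa [z] using div_le_div_of_nonneg_right this (hc z).le
  · have := hc j
    positivity

theorem stmt_17 (N M : ℕ) (hN : 1 ≤ N) (c : Fin N → ℝ) (hc : ∀ j, 0 < c j)
    (ρ : ℝ) (hρ : 0 < ρ) (hMN : 1 < N → N ≤ M) :
    (∀ u : Fin N → ℂ, u ≠ 0 → ∀ X : Matrix (Fin N) (Fin N) ℂ, IsMP (Hc c u) X →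
      IsLeast { C : ℝ |
          ((C : ℂ) • Hc c u - Matrix.vecMulVec (uPow u M) (star (uPow u M))).PosSemidef }
        ((star (uPow u M) ⬝ᵥ X *ᵥ uPow u M).re))
    ∧ IsLeast { C : ℝ |
        ((C : ℂ) • Hc c (fun _ => (Real.sqrt ρ : ℂ))
          - Matrix.vecMulVec (uPow (fun _ => (Real.sqrt ρ : ℂ)) M)
              (star (uPow (fun _ => (Real.sqrt ρ : ℂ)) M))).PosSemidef }
      (ρ ^ M / ∑ j : Fin N, c j * ρ ^ (j : ℕ))
    ∧ ρ ^ M / (∑ j : Fin N, c j * ρ ^ (j : ℕ)) ≤ CC N c M ρ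
    ∧ (ρ ^ M / (∑ j : Fin N, c j * ρ ^ (j : ℕ)) = CC N c M ρ ↔ N = 1) := by
  refine ⟨fun u hu X hX => isLeast_of_isMP M hc hu hX, isLeast_const_sqrt M hN hc hρ, ?_⟩
  obtain rfl | hN1 := hN.eq_or_lt
  · simp [CC_one]
  · have h := div_sum_lt_CC hN1 (hMN hN1) hc hρ
    exact ⟨h.le, iff_of_false h.ne hN1.ne'⟩
end
end

section
/- Fix a subgroup G ⊆ ℂ^× (the multiplicative group of nonzero complex numbers), an integer N ≥ 1, and a nonzero matrix A ∈ 𝒫_N(ℂ). (1) Suppose {I_1, …, I_k} is a partition of {1,…,N} such that each diagonal block A_{I_j} has rank at most one, so A_{I_j} = u_j u_j* for a unique vector u_j ∈ ℂ^{|I_j|} whose first entry is in [0,∞), and such that all entries of each diagonal block A_{I_j} lie in a single G-orbit of ℂ (where G acts by multiplication). Then there exists a unique k×k matrix C = (c_{ij}) with c_{ij} = 0 unless both u_i ≠ 0 and u_j ≠ 0, such that the block A_{I_i×I_j} equals c_{ij} u_i u_j* for all 1 ≤ i, j ≤ k; moreover the entries of each off-diagonal block of A lie in a single G-orbit, C ∈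 𝒫_k(D̄(0,1)), and rank A = rank C. (2) If, in addition, each diagonal block is required to be maximal (i.e., no I_j is properly contained in a set I ⊆ {1,…,N} such that A_I has rank at most one and its entries lie in a single G-orbit), then such a partition exists and is unique up to relabelling. (3) If (1) and (2) hold and G = ℂ^×, then the off-diagonal entries of C lie in the open unit disc D(0,1). -/
open scoped ComplexOrder Matrix

noncomputable section

/-- The principal submatrix of `A` with rows in `s` and columns in `t`. -/
def subBlock {N : ℕ} (A : Matrix (Fin N) (Fin N) ℂ) (s t : Finset (Fin N)) :
    Matrix s t ℂ :=
  Matrix.of fun p q => A p.1 q.1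

/-- All the entries `A p q`, `p ∈ s`, `q ∈ t`, lie in a single `G`-orbit of `ℂ`
(where `G ⊆ ℂˣ` acts by multiplication). -/
def SingleOrbit (G : Subgroup ℂˣ) {N : ℕ} (A : Matrix (Fin N) (Fin N) ℂ)
    (s t : Finset (Fin N)) : Prop :=
  ∃ z : ℂ, ∀ p ∈ s, ∀ q ∈ t, ∃ g ∈ G, A p q = (g : ℂ) * z

/-- `P` is a partition of `{1,…,N}` all of whose diagonal blocks of `A` have rank at most
one and have all entries in a single `G`-orbit. -/
def IsGoodPartition (G : Subgroup ℂˣ) {N : ℕ} (A : Matrix (Fin N) (Fin N) ℂ)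
    (P : Finset (Finset (Fin N))) : Prop :=
  (∀ s ∈ P, s.Nonempty) ∧
  (P : Set (Finset (Fin N))).PairwiseDisjoint id ∧
  (∀ i : Fin N, ∃ s ∈ P, i ∈ s) ∧
  (∀ s ∈ P, (subBlock A s s).rank ≤ 1) ∧
  (∀ s ∈ P, SingleOrbit G A s s)

/-- Each block of `P` is of maximal size: it is not properly contained in a larger diagonal
block of rank at most one whose entries lie in a single `G`-orbit. -/
def IsMaximalPartition (G : Subgroup ℂˣ) {N : ℕ} (A : Matrix (Fin N) (Fin N) ℂ)
    (P : Finset (Finset (Fin N))) : Prop :=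
  ∀ s ∈ P, ∀ I : Finset (Fin N), s ⊆ I →
    (subBlock A I I).rank ≤ 1 → SingleOrbit G A I I → I = s

/-- `u` encodes the rank-one decompositions `A_{I_j} = u_j u_j^*` of the diagonal blocks,
with the first entry of each `u_j` (i.e. the entry at the least index of the block)
non-negative real. -/
def GaugeVec {N : ℕ} (A : Matrix (Fin N) (Fin N) ℂ) (P : Finset (Finset (Fin N)))
    (u : Fin N → ℂ) : Prop :=
  ∀ s ∈ P, (∀ p ∈ s, ∀ q ∈ s, A p q = u p * (starRingEnd ℂ) (u q)) ∧
    (∀ p ∈ s, (∀ q ∈ s, p ≤ q) → (u p).im = 0 ∧ 0 ≤ (u p).re)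

/-- `C = (c_{ij})` is a matrix indexed by the blocks of `P` satisfying `c_{ij} = 0` unless
`u_i ≠ 0` and `u_j ≠ 0`, and `A_{I_i × I_j} = c_{ij} u_i u_j^*` for all `i, j`. -/
def BlockMatrixSpec {N : ℕ} (A : Matrix (Fin N) (Fin N) ℂ) (P : Finset (Finset (Fin N)))
    (u : Fin N → ℂ) (C : Matrix P P ℂ) : Prop :=
  (∀ i j : P, ¬((∃ p ∈ i.1, u p ≠ 0) ∧ (∃ q ∈ j.1, u q ≠ 0)) → C i j = 0) ∧
  (∀ i j : P, ∀ p ∈ i.1, ∀ q ∈ j.1, A p q = C i j * (u p * (starRingEnd ℂ) (u q)))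

/-- Rows `p` and `q` of `A` differ by a factor `g` such that `g` and its conjugate lie in `G`. -/
def RowAssoc (G : Subgroup ℂˣ) {N : ℕ} (A : Matrix (Fin N) (Fin N) ℂ) (p q : Fin N) : Prop :=
  ∃ g ∈ G, star g ∈ G ∧ ∀ x, A p x = (g : ℂ) * A q x

namespace RowAssoc

variable {G : Subgroup ℂˣ} {N : ℕ} {A : Matrix (Fin N) (Fin N) ℂ} {p q r : Fin N}

theorem refl (p : Fin N) : RowAssoc G A p p :=
  ⟨1, G.one_mem, by simp [G.one_mem], by simp⟩

theorem symm (h : RowAssoc G A p q) : RowAssoc G A q p := by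
  obtain ⟨g, hg, hg', h⟩ := h
  refine ⟨g⁻¹, G.inv_mem hg, by simpa using hg', fun x => ?_⟩
  rw [h, Units.inv_mul_cancel_left]

theorem trans (h : RowAssoc G A p q) (h' : RowAssoc G A q r) : RowAssoc G A p r := by
  obtain ⟨g, hg, hg', h⟩ := h
  obtain ⟨k, hk, hk', h'⟩ := h'
  refine ⟨g * k, G.mul_mem hg hk, by rw [star_mul']; exact G.mul_mem hg' hk', fun x => ?_⟩
  rw [h, h', Units.val_mul, mul_assoc]

theorem exists_ne_zero (h : RowAssoc G A p q) : ∃ g : ℂ, g ≠ 0 ∧ ∀ x, A p x = g * A q x := by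
  obtain ⟨g, _, _, h⟩ := h
  exact ⟨g, g.ne_zero, h⟩

end RowAssoc

section Hermitian

variable {N : ℕ} {A : Matrix (Fin N) (Fin N) ℂ}

theorem posSemidef_row_eq_zero (hA : A.PosSemidef) {p : Fin N} (h : A p p = 0) (x : Fin N) :
    A p x = 0 := by
  have h0 : A *ᵥ Pi.single p 1 = 0 := by
    rw [← hA.dotProduct_mulVec_zero_iff]
    simp [h]
  have h1 : A x p = 0 := by simpa using congrFun h0 x
  rw [← hA.1.apply, h1, star_zero]

/-- If a `2 × 2` principal minor of `A` vanishes, the two rows are proportional. -/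
theorem posSemidef_rows_proportional (hA : A.PosSemidef) {p q : Fin N}
    (h : A p q * A q p = A p p * A q q) (x : Fin N) : A p x * A q q = A p q * A q x := by
  have hs : ∀ a b, star (A a b) = A b a := fun a b => hA.1.apply b a
  have key : ∀ y, (A *ᵥ (Pi.single p (A q q) - Pi.single q (A q p))) y
      = A y p * A q q - A y q * A q p := by
    intro y
    simp [Matrix.mulVec_sub, mul_comm]
  have h0 : A *ᵥ (Pi.single p (A q q) - Pi.single q (A q p)) = 0 := by
    rw [← hA.dotProduct_mulVec_zero_iff, star_sub, sub_dotProduct, ← Pi.single_star,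
      ← Pi.single_star, single_dotProduct, single_dotProduct, key, key, hs, hs]
    linear_combination (-A q q) * h
  have h1 : A x p * A q q - A x q * A q p = 0 := by rw [← key, h0]; rfl
  have h2 := congrArg star h1
  simp only [star_sub, star_mul', hs, star_zero] at h2
  linear_combination h2

theorem minor_eq_zero_of_rank_le_one {m : Type*} [Fintype m] {B : Matrix m m ℂ}
    (h : B.rank ≤ 1) (a b : m) : B a b * B b a = B a a * B b b := by
  by_contra hne
  have hr : (B.submatrix ![a, b] ![a, b]).rank = 2 := by
    rw [Matrix.rank_of_isUnit, Fintype.card_fin]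
    rw [Matrix.isUnit_iff_isUnit_det, Matrix.det_fin_two, isUnit_iff_ne_zero]
    simp only [Matrix.submatrix_apply, Matrix.cons_val_zero, Matrix.cons_val_one]
    exact fun h0 => hne (by linear_combination -h0)
  have := B.rank_submatrix_le ![a, b] ![a, b]
  omega

theorem posSemidef_norm_apply_le_one {m : Type*} [Fintype m] {B : Matrix m m ℂ} (hB : B.PosSemidef)
    (h1 : ∀ i, B i i = 0 ∨ B i i = 1) (a b : m) : ‖B a b‖ ≤ 1 := by
  have hd := (hB.submatrix ![a, b]).det_nonneg
  rw [Matrix.det_fin_two] at hd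
  simp only [Matrix.submatrix_apply, Matrix.cons_val_zero, Matrix.cons_val_one] at hd
  rw [← hB.1.apply b a, Complex.star_def, Complex.mul_conj, Complex.normSq_eq_norm_sq] at hd
  have hd' := (Complex.le_def.1 hd).1
  have h2 : (B a a * B b b).re ≤ 1 := by
    rcases h1 a with h | h <;> rcases h1 b with h' | h' <;> simp [h, h']
  rw [Complex.sub_re, Complex.ofReal_re, Complex.zero_re] at hd'
  nlinarith [norm_nonneg (B a b)]

end Hermitian

section Blocks

variable {G : Subgroup ℂˣ} {N : ℕ} {A : Matrix (Fin N) (Fin N) ℂ}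

theorem rowAssoc_of_mem_block (hA : A.PosSemidef) {s : Finset (Fin N)}
    (hr : (subBlock A s s).rank ≤ 1) (ho : SingleOrbit G A s s) {p q : Fin N}
    (hp : p ∈ s) (hq : q ∈ s) : RowAssoc G A p q := by
  obtain ⟨z, hz⟩ := ho
  by_cases hz0 : z = 0
  · have hrow : ∀ a ∈ s, ∀ x, A a x = 0 := fun a ha => posSemidef_row_eq_zero hA (by
      obtain ⟨g, _, h⟩ := hz a ha a ha
      rw [h, hz0, mul_zero])
    exact ⟨1, G.one_mem, by simp [G.one_mem], fun x => by simp [hrow p hp, hrow q hq]⟩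
  · have hm : A p q * A q p = A p p * A q q :=
      minor_eq_zero_of_rank_le_one hr ⟨p, hp⟩ ⟨q, hq⟩
    obtain ⟨a, ha, hpq⟩ := hz p hp q hq
    obtain ⟨b, hb, hqp⟩ := hz q hq p hp
    obtain ⟨c, hc, hqq⟩ := hz q hq q hq
    have hc0 : (c : ℂ) ≠ 0 := c.ne_zero
    refine ⟨a * c⁻¹, G.mul_mem ha (G.inv_mem hc), ?_, fun x => ?_⟩
    · have : star (a * c⁻¹) = b * c⁻¹ := by
        have e1 : star (A p q) = A q p := hA.1.apply q p
        have e2 : star (A q q) = A q q := hA.1.apply q q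
        rw [hpq, hqp, star_mul'] at e1
        rw [hqq, star_mul'] at e2
        have hz1 : star z ≠ 0 := star_ne_zero.2 hz0
        have hc1 : star (c : ℂ) ≠ 0 := star_ne_zero.2 hc0
        ext
        simp only [Units.val_mul, Units.coe_star, star_mul', star_inv₀,
          Units.val_inv_eq_inv_val]
        rw [← div_eq_mul_inv, ← div_eq_mul_inv, div_eq_div_iff hc1 hc0]
        apply mul_right_cancel₀ (mul_ne_zero hz0 hz1)
        linear_combination (c : ℂ) * z * e1 - (b : ℂ) * z * e2
      rw [this]
      exact G.mul_mem hb (G.inv_mem hc)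
    · have h := posSemidef_rows_proportional hA hm x
      rw [hpq, hqq] at h
      simp only [Units.val_mul, Units.val_inv_eq_inv_val]
      field_simp
      apply mul_right_cancel₀ hz0
      linear_combination h

theorem singleOrbit_of_rowAssoc (hA : A.PosSemidef) {s t : Finset (Fin N)}
    (hs : ∀ p ∈ s, ∀ q ∈ s, RowAssoc G A p q) (ht : ∀ p ∈ t, ∀ q ∈ t, RowAssoc G A p q) :
    SingleOrbit G A s t := by
  rcases s.eq_empty_or_nonempty with rfl | ⟨p₀, hp₀⟩
  · exact ⟨0, by simp⟩
  rcases t.eq_empty_or_nonempty with rfl | ⟨q₀, hq₀⟩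
  · exact ⟨0, by simp⟩
  refine ⟨A p₀ q₀, fun p hp q hq => ?_⟩
  obtain ⟨g, hg, _, h⟩ := hs p hp p₀ hp₀
  obtain ⟨k, _, hk, h'⟩ := ht q hq q₀ hq₀
  refine ⟨g * star k, G.mul_mem hg hk, ?_⟩
  rw [h, ← hA.1.apply p₀ q, h', star_mul', hA.1.apply, Units.val_mul, Units.coe_star, mul_assoc]

theorem rank_subBlock_le_one_of_rowAssoc {s : Finset (Fin N)}
    (hs : ∀ p ∈ s, ∀ q ∈ s, RowAssoc G A p q) : (subBlock A s s).rank ≤ 1 := by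
  rcases s.eq_empty_or_nonempty with rfl | ⟨p₀, hp₀⟩
  · exact (Matrix.rank_le_card_width _).trans (by simp)
  choose g _ _ hg using fun p : s => hs p p.2 p₀ hp₀
  have : subBlock A s s = Matrix.vecMulVec (fun p => (g p : ℂ)) (fun q : s => A p₀ q) := by
    ext p q
    exact hg p q
  rw [this]
  exact Matrix.rank_vecMulVec_le _ _

/-- In a block with pairwise proportional rows, a decomposition `A_s = u u^*` determines the
proportionality factors. -/
theorem gauge_rows_proportional (hA : A.PosSemidef) {s : Finset (Fin N)} {u : Fin N → ℂ}
    (hs : ∀ p ∈ s, ∀ q ∈ s, RowAssoc G A p q)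
    (hu : ∀ p ∈ s, ∀ q ∈ s, A p q = u p * (starRingEnd ℂ) (u q))
    {p q : Fin N} (hp : p ∈ s) (hq : q ∈ s) :
    (u q = 0 → u p = 0) ∧ (u q = 0 → ∀ x, A p x = 0) ∧
      ∀ x, u q * A p x = u p * A q x := by
  obtain ⟨g, hg0, hg⟩ := (hs p hp q hq).exists_ne_zero
  have hrow : u q = 0 → ∀ x, A p x = 0 := fun h x => by
    rw [hg, posSemidef_row_eq_zero hA (by rw [hu q hq q hq, h, zero_mul]), mul_zero]
  have hzero : u q = 0 → u p = 0 := fun h => by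
    simpa [hu p hp p hp] using hrow h p
  refine ⟨hzero, hrow, fun x => ?_⟩
  by_cases h : u q = 0
  · rw [h, hzero h, zero_mul, zero_mul]
  · have h1 := hg q
    rw [hu p hp q hq, hu q hq q hq, ← mul_assoc] at h1
    rw [hg, mul_right_cancel₀ (by simpa using h) h1]
    ring

theorem existsUnique_block_gauge (hA : A.PosSemidef) {s : Finset (Fin N)} (hne : s.Nonempty)
    (hs : ∀ p ∈ s, ∀ q ∈ s, RowAssoc G A p q) :
    (∃ v : Fin N → ℂ, (∀ p ∈ s, ∀ q ∈ s, A p q = v p * (starRingEnd ℂ) (v q)) ∧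
      (∀ p ∈ s, (∀ q ∈ s, p ≤ q) → (v p).im = 0 ∧ 0 ≤ (v p).re)) ∧
    ∀ v w : Fin N → ℂ, ((∀ p ∈ s, ∀ q ∈ s, A p q = v p * (starRingEnd ℂ) (v q)) ∧
      (∀ p ∈ s, (∀ q ∈ s, p ≤ q) → (v p).im = 0 ∧ 0 ≤ (v p).re)) →
      ((∀ p ∈ s, ∀ q ∈ s, A p q = w p * (starRingEnd ℂ) (w q)) ∧
      (∀ p ∈ s, (∀ q ∈ s, p ≤ q) → (w p).im = 0 ∧ 0 ≤ (w p).re)) → ∀ p ∈ s, v p = w p := by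
  obtain ⟨m, hm, hmin⟩ : ∃ m ∈ s, ∀ q ∈ s, m ≤ q :=
    ⟨s.min' hne, s.min'_mem hne, fun q hq => s.min'_le q hq⟩
  constructor
  · obtain ⟨a, ha, hma⟩ : ∃ a : ℝ, 0 ≤ a ∧ A m m = a * a := by
      have h := Complex.le_def.1 (hA.diag_nonneg (i := m))
      refine ⟨√(A m m).re, Real.sqrt_nonneg _, ?_⟩
      rw [← Complex.ofReal_mul, Real.mul_self_sqrt (by simpa using h.1)]
      exact Complex.ext (by simp) (by simpa using h.2.symm)
    have hcol : ∀ q, (starRingEnd ℂ) (A q m) = A m q := fun q => hA.1.apply m q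
    refine ⟨fun p => A p m / a, fun p hp q hq => ?_, fun p hp hpmin => ?_⟩
    · obtain ⟨g, -, hg⟩ := (hs p hp m hm).exists_ne_zero
      beta_reduce
      rw [map_div₀, hcol, Complex.conj_ofReal, hg, hg, hma]
      by_cases h0 : a = 0
      · rw [posSemidef_row_eq_zero hA (by rw [hma, h0]; simp)]
        simp
      · have : (a : ℂ) ≠ 0 := by exact_mod_cast h0
        field_simp
    · obtain rfl : p = m := le_antisymm (hpmin m hm) (hmin p hp)
      have : A p p / a = a := by
        rw [hma, mul_self_div_self]
      simp only [this]
      exact ⟨Complex.ofReal_im a, by simpa using ha⟩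
  · intro v w hv hw p hp
    obtain ⟨him, hre⟩ := hv.2 m hm hmin
    obtain ⟨him', hre'⟩ := hw.2 m hm hmin
    have hmm : v m = w m := by
      have h := (hv.1 m hm m hm).symm.trans (hw.1 m hm m hm)
      rw [Complex.mul_conj, Complex.mul_conj, Complex.ofReal_inj, Complex.normSq_apply,
        Complex.normSq_apply, him, him'] at h
      refine Complex.ext ?_ (him.trans him'.symm)
      nlinarith
    by_cases h0 : v m = 0
    · rw [(gauge_rows_proportional hA hs hv.1 hp hm).1 h0,
        (gauge_rows_proportional hA hs hw.1 hp hm).1 (hmm ▸ h0)]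
    · have h := (hv.1 p hp m hm).symm.trans (hw.1 p hp m hm)
      rw [← hmm] at h
      exact mul_right_cancel₀ (by simpa using h0) h

end Blocks

section Partition

variable {G : Subgroup ℂˣ} {N : ℕ} {A : Matrix (Fin N) (Fin N) ℂ}
  {P : Finset (Finset (Fin N))}

theorem IsGoodPartition.rowAssoc (hA : A.PosSemidef) (hP : IsGoodPartition G A P)
    {s : Finset (Fin N)} (hs : s ∈ P) : ∀ p ∈ s, ∀ q ∈ s, RowAssoc G A p q :=
  fun _ hp _ hq => rowAssoc_of_mem_block hA (hP.2.2.2.1 s hs) (hP.2.2.2.2 s hs) hp hq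

theorem IsGoodPartition.eq_of_mem (hP : IsGoodPartition G A P) {s t : Finset (Fin N)}
    (hs : s ∈ P) (ht : t ∈ P) {p : Fin N} (hps : p ∈ s) (hpt : p ∈ t) : s = t := by
  by_contra hne
  exact Finset.disjoint_left.1 (hP.2.1 hs ht hne) hps hpt

theorem IsGoodPartition.existsUnique_gaugeVec (hA : A.PosSemidef)
    (hP : IsGoodPartition G A P) : ∃! u : Fin N → ℂ, GaugeVec A P u := by
  have hb := fun s (hs : s ∈ P) => existsUnique_block_gauge hA (hP.1 s hs) (hP.rowAssoc hA hs)
  choose b hbP hb' using hP.2.2.1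
  choose v hv using fun s hs => (hb s hs).1
  refine ⟨fun p => v (b p) (hbP p) p, fun s hs => ?_, fun w hw => funext fun p => ?_⟩
  · have he : ∀ p ∈ s, v (b p) (hbP p) p = v s hs p := fun p hp => by
      have hbs : b p = s := hP.eq_of_mem (hbP p) hs (hb' p) hp
      congr!
    refine ⟨fun p hp q hq => ?_, fun p hp hmin => ?_⟩
    · simp only [he p hp, he q hq]
      exact (hv s hs).1 p hp q hq
    · simp only [he p hp]
      exact (hv s hs).2 p hp hmin
  · exact (hb (b p) (hbP p)).2 w _ (hw (b p) (hbP p)) (hv (b p) (hbP p)) p (hb' p)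

/-- The entries of `C` are read off from arbitrary block representatives. -/
theorem BlockMatrixSpec.apply_eq (hA : A.PosSemidef) (hP : IsGoodPartition G A P)
    {u : Fin N → ℂ} (hu : GaugeVec A P u) {C : Matrix P P ℂ} (hC : BlockMatrixSpec A P u C)
    (i j : P) {p q : Fin N} (hp : p ∈ i.1) (hq : q ∈ j.1) :
    C i j = A p q / (u p * (starRingEnd ℂ) (u q)) := by
  have hzero : ∀ (k : P) (r : Fin N), r ∈ k.1 → u r = 0 → ¬∃ x ∈ k.1, u x ≠ 0 := by
    rintro k r hr h0 ⟨x, hx, hx0⟩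
    exact hx0 ((gauge_rows_proportional hA (hP.rowAssoc hA k.2) (hu k.1 k.2).1 hx hr).1 h0)
  by_cases hp0 : u p = 0
  · rw [hC.1 i j fun h => hzero i p hp hp0 h.1, hp0, zero_mul, div_zero]
  by_cases hq0 : u q = 0
  · rw [hC.1 i j fun h => hzero j q hq hq0 h.2, hq0, map_zero, mul_zero, div_zero]
  rw [hC.2 i j p hp q hq, mul_div_cancel_right₀]
  exact mul_ne_zero hp0 (by simpa using hq0)

theorem IsGoodPartition.existsUnique_blockMatrix (hA : A.PosSemidef)
    (hP : IsGoodPartition G A P) {u : Fin N → ℂ} (hu : GaugeVec A P u) :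
    ∃! C : Matrix P P ℂ, BlockMatrixSpec A P u C := by
  choose r hr using fun i : P => hP.1 i.1 i.2
  have hg := fun (i : P) (p : Fin N) (hp : p ∈ i.1) (q : Fin N) (hq : q ∈ i.1) =>
    gauge_rows_proportional hA (hP.rowAssoc hA i.2) (hu i.1 i.2).1 hp hq
  refine ⟨Matrix.of fun i j => A (r i) (r j) / (u (r i) * (starRingEnd ℂ) (u (r j))),
    ⟨fun i j h => ?_, fun i j p hp q hq => ?_⟩,
    fun C hC => Matrix.ext fun i j => hC.apply_eq hA hP hu i j (hr i) (hr j)⟩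
  · have : u (r i) * (starRingEnd ℂ) (u (r j)) = 0 := by
      by_contra hne
      exact h ⟨⟨r i, hr i, left_ne_zero_of_mul hne⟩,
        ⟨r j, hr j, by simpa using right_ne_zero_of_mul hne⟩⟩
    rw [Matrix.of_apply, this, div_zero]
  · have hs : ∀ a b, (starRingEnd ℂ) (A a b) = A b a := fun a b => hA.1.apply b a
    rw [Matrix.of_apply]
    by_cases hi : u (r i) = 0
    · rw [(hg i p hp _ (hr i)).2.1 hi, hi]
      simp
    by_cases hj : u (r j) = 0
    · rw [← hs, (hg j q hq _ (hr j)).2.1 hj, hj]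
      simp
    have hj' : (starRingEnd ℂ) (u (r j)) ≠ 0 := by simpa using hj
    have e1 := (hg i p hp _ (hr i)).2.2 q
    have e2 := congrArg (starRingEnd ℂ) ((hg j q hq _ (hr j)).2.2 (r i))
    simp only [map_mul, hs] at e2
    rw [div_mul_eq_mul_div, eq_div_iff (mul_ne_zero hi hj')]
    linear_combination (starRingEnd ℂ) (u (r j)) * e1 + u p * e2

theorem BlockMatrixSpec.diag_eq (hA : A.PosSemidef) (hP : IsGoodPartition G A P)
    {u : Fin N → ℂ} (hu : GaugeVec A P u) {C : Matrix P P ℂ} (hC : BlockMatrixSpec A P u C)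
    (i : P) : C i i = 0 ∨ C i i = 1 := by
  obtain ⟨p, hp⟩ := hP.1 i.1 i.2
  rw [hC.apply_eq hA hP hu i i hp hp, (hu i.1 i.2).1 p hp p hp]
  by_cases h : u p * (starRingEnd ℂ) (u p) = 0
  · exact Or.inl (by rw [h, div_zero])
  · exact Or.inr (div_self h)

theorem BlockMatrixSpec.posSemidef_and_rank_eq (hA : A.PosSemidef)
    (hP : IsGoodPartition G A P) {u : Fin N → ℂ} (hu : GaugeVec A P u) {C : Matrix P P ℂ}
    (hC : BlockMatrixSpec A P u C) : C.PosSemidef ∧ A.rank = C.rank := by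
  classical
  choose r hr using fun i : P => hP.1 i.1 i.2
  choose b hbP hb using hP.2.2.1
  have hCA : C = Matrix.diagonal (fun i => (u (r i))⁻¹) * A.submatrix r r *
      (Matrix.diagonal fun i => (u (r i))⁻¹)ᴴ := by
    ext i j
    rw [hC.apply_eq hA hP hu i j (hr i) (hr j), Matrix.diagonal_conjTranspose,
      Matrix.mul_diagonal, Matrix.diagonal_mul, Matrix.submatrix_apply, Pi.star_apply,
      star_inv₀, div_eq_mul_inv, mul_inv, Complex.star_def]
    ring
  let U : Matrix (Fin N) P ℂ := Matrix.of fun p i => if i = ⟨b p, hbP p⟩ then u p else 0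
  have hAC : A = U * C * Uᴴ := by
    ext p q
    rw [hC.2 ⟨b p, hbP p⟩ ⟨b q, hbP q⟩ p (hb p) q (hb q)]
    simp only [U, Matrix.mul_apply, Matrix.of_apply, ite_mul, zero_mul, Finset.sum_ite_eq',
      Finset.mem_univ, if_true, Matrix.conjTranspose_apply, apply_ite star, star_zero, mul_ite,
      mul_zero, Complex.star_def]
    ring
  refine ⟨?_, le_antisymm ?_ ?_⟩
  · rw [hCA]
    exact (hA.submatrix r).mul_mul_conjTranspose_same _
  · conv_lhs => rw [hAC]
    exact (Matrix.rank_mul_le_left _ _).trans (Matrix.rank_mul_le_right _ _)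
  · rw [hCA]
    exact (Matrix.rank_mul_le_left _ _).trans
      ((Matrix.rank_mul_le_right _ _).trans (A.rank_submatrix_le r r))

/-- The blocks of a maximal partition are the classes of proportional rows. -/
theorem IsMaximalPartition.mem_of_rowAssoc (hA : A.PosSemidef) (hP : IsGoodPartition G A P)
    (hmax : IsMaximalPartition G A P) {s : Finset (Fin N)} (hs : s ∈ P) {p q : Fin N}
    (hp : p ∈ s) (h : RowAssoc G A p q) : q ∈ s := by
  classical
  have hI : ∀ a ∈ insert q s, RowAssoc G A a p := by
    intro a ha
    rcases Finset.mem_insert.1 ha with rfl | ha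
    · exact h.symm
    · exact hP.rowAssoc hA hs a ha p hp
  have hI' : ∀ a ∈ insert q s, ∀ b ∈ insert q s, RowAssoc G A a b :=
    fun a ha b hb => (hI a ha).trans (hI b hb).symm
  rw [← hmax s hs (insert q s) (Finset.subset_insert q s)
    (rank_subBlock_le_one_of_rowAssoc hI') (singleOrbit_of_rowAssoc hA hI' hI')]
  exact Finset.mem_insert_self q s

theorem maximalPartition_subset (hA : A.PosSemidef) {Q : Finset (Finset (Fin N))}
    (hP : IsGoodPartition G A P) (hPm : IsMaximalPartition G A P)
    (hQ : IsGoodPartition G A Q) (hQm : IsMaximalPartition G A Q) : P ⊆ Q := by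
  intro s hs
  obtain ⟨p, hp⟩ := hP.1 s hs
  obtain ⟨t, ht, hpt⟩ := hQ.2.2.1 p
  have : s = t := by
    ext q
    exact ⟨fun hq => hQm.mem_of_rowAssoc hA hQ ht hpt (hP.rowAssoc hA hs p hp q hq),
      fun hq => hPm.mem_of_rowAssoc hA hP hs hp (hQ.rowAssoc hA ht p hpt q hq)⟩
  exact this ▸ ht

theorem existsUnique_maximalPartition (hA : A.PosSemidef) :
    ∃! P : Finset (Finset (Fin N)), IsGoodPartition G A P ∧ IsMaximalPartition G A P := by
  classical
  refine existsUnique_of_exists_of_unique ?_ fun P Q hP hQ =>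
    (maximalPartition_subset hA hP.1 hP.2 hQ.1 hQ.2).antisymm
      (maximalPartition_subset hA hQ.1 hQ.2 hP.1 hP.2)
  let cls : Fin N → Finset (Fin N) := fun p => Finset.univ.filter fun q => RowAssoc G A p q
  have hmem : ∀ p q, q ∈ cls p ↔ RowAssoc G A p q := fun p q => by simp [cls]
  have hcls : ∀ p, ∀ a ∈ cls p, ∀ b ∈ cls p, RowAssoc G A a b := fun p a ha b hb =>
    ((hmem p a).1 ha).symm.trans ((hmem p b).1 hb)
  have hP : ∀ s, s ∈ Finset.univ.image cls ↔ ∃ p, cls p = s := by simp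
  refine ⟨Finset.univ.image cls, ⟨?_, ?_, ?_, ?_, ?_⟩, ?_⟩
  · intro s hs
    obtain ⟨p, rfl⟩ := (hP s).1 hs
    exact ⟨p, (hmem p p).2 (.refl p)⟩
  · intro s hs t ht hne
    obtain ⟨p, rfl⟩ := (hP s).1 hs
    obtain ⟨q, rfl⟩ := (hP t).1 ht
    refine Finset.disjoint_left.2 fun a ha hb => hne ?_
    have hpq := ((hmem p a).1 ha).trans ((hmem q a).1 hb).symm
    ext x
    rw [hmem, hmem]
    exact ⟨hpq.symm.trans, hpq.trans⟩
  · exact fun p => ⟨cls p, (hP _).2 ⟨p, rfl⟩, (hmem p p).2 (.refl p)⟩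
  · intro s hs
    obtain ⟨p, rfl⟩ := (hP s).1 hs
    exact rank_subBlock_le_one_of_rowAssoc (hcls p)
  · intro s hs
    obtain ⟨p, rfl⟩ := (hP s).1 hs
    exact singleOrbit_of_rowAssoc hA (hcls p) (hcls p)
  · intro s hs I hsI hr ho
    obtain ⟨p, rfl⟩ := (hP s).1 hs
    refine Finset.Subset.antisymm (fun q hq => (hmem p q).2 ?_) hsI
    exact rowAssoc_of_mem_block hA hr ho (hsI ((hmem p p).2 (.refl p))) hq

theorem BlockMatrixSpec.norm_ne_one (hA : A.PosSemidef) (hP : IsGoodPartition ⊤ A P)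
    (hmax : IsMaximalPartition ⊤ A P) {u : Fin N → ℂ} (hu : GaugeVec A P u)
    {C : Matrix P P ℂ} (hC : BlockMatrixSpec A P u C) {i j : P} (hij : i ≠ j) :
    ‖C i j‖ ≠ 1 := by
  intro h1
  have hC0 : C i j ≠ 0 := fun h => by simp [h] at h1
  obtain ⟨⟨p, hp, hp0⟩, ⟨q, hq, hq0⟩⟩ := not_not.1 fun h => hC0 (hC.1 i j h)
  have hpq := hC.2 i j p hp q hq
  have hqq := (hu j.1 j.2).1 q hq q hq
  have hqp : A q p = (starRingEnd ℂ) (A p q) := (hA.1.apply q p).symm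
  have hCC : C i j * (starRingEnd ℂ) (C i j) = 1 := by
    rw [Complex.mul_conj, Complex.normSq_eq_norm_sq, h1]
    simp
  have hq1 : (starRingEnd ℂ) (u q) ≠ 0 := by simpa using hq0
  have hqq0 : A q q ≠ 0 := by rw [hqq]; exact mul_ne_zero hq0 hq1
  have hpq0 : A p q ≠ 0 := by rw [hpq]; exact mul_ne_zero hC0 (mul_ne_zero hp0 hq1)
  have hminor : A p q * A q p = A p p * A q q := by
    rw [hqp, hpq, hqq, (hu i.1 i.2).1 p hp p hp]
    simp only [map_mul, Complex.conj_conj]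
    linear_combination
      (u p * (starRingEnd ℂ) (u p) * (u q * (starRingEnd ℂ) (u q))) * hCC
  have hR : RowAssoc ⊤ A p q :=
    ⟨Units.mk0 _ (div_ne_zero hpq0 hqq0), Subgroup.mem_top _, Subgroup.mem_top _, fun x => by
      rw [Units.val_mk0, div_mul_eq_mul_div, eq_div_iff hqq0]
      exact posSemidef_rows_proportional hA hminor x⟩
  exact hij (Subtype.ext
    (hP.eq_of_mem i.2 j.2 (hmax.mem_of_rowAssoc hA hP i.2 hp hR) hq))

end Partition

theorem stmt_18 (G : Subgroup ℂˣ) (N : ℕ) (hN : 1 ≤ N)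
    (A : Matrix (Fin N) (Fin N) ℂ) (hA : A.PosSemidef) (hA0 : A ≠ 0) :
    -- (1)
    (∀ P : Finset (Finset (Fin N)), IsGoodPartition G A P →
      (∃! u : Fin N → ℂ, GaugeVec A P u) ∧
      (∀ u : Fin N → ℂ, GaugeVec A P u →
        (∃! C : Matrix P P ℂ, BlockMatrixSpec A P u C) ∧
        (∀ C : Matrix P P ℂ, BlockMatrixSpec A P u C →
          C.PosSemidef ∧ (∀ i j : P, ‖C i j‖ ≤ 1) ∧ A.rank = C.rank)) ∧
      (∀ s ∈ P, ∀ t ∈ P, s ≠ t → SingleOrbit G A s t))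
    -- (2)
    ∧ (∃! P : Finset (Finset (Fin N)),
        IsGoodPartition G A P ∧ IsMaximalPartition G A P)
    -- (3)
    ∧ (G = ⊤ → ∀ P : Finset (Finset (Fin N)),
        IsGoodPartition G A P → IsMaximalPartition G A P →
        ∀ u : Fin N → ℂ, GaugeVec A P u →
        ∀ C : Matrix P P ℂ, BlockMatrixSpec A P u C →
        ∀ i j : P, i ≠ j → ‖C i j‖ < 1) := by
  refine ⟨fun P hP => ⟨hP.existsUnique_gaugeVec hA, fun u hu =>
    ⟨hP.existsUnique_blockMatrix hA hu, fun C hC => ?_⟩, fun s hs t ht _ =>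
    singleOrbit_of_rowAssoc hA (hP.rowAssoc hA hs) (hP.rowAssoc hA ht)⟩,
    existsUnique_maximalPartition hA, ?_⟩
  · obtain ⟨hpsd, hrank⟩ := hC.posSemidef_and_rank_eq hA hP hu
    exact ⟨hpsd, posSemidef_norm_apply_le_one hpsd (hC.diag_eq hA hP hu), hrank⟩
  · rintro rfl P hP hmax u hu C hC i j hij
    exact lt_of_le_of_ne
      (posSemidef_norm_apply_le_one (hC.posSemidef_and_rank_eq hA hP hu).1 (hC.diag_eq hA hP hu) i j)
      (hC.norm_ne_one hA hP hmax hu hij)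
end
end

section
/- Let A ∈ 𝒫_N(ℂ) and let {I_1, …, I_k} be the unique partition of {1,…,N} such that each diagonal block A_{I_j} has all its entries equal and each I_j is maximal with this property (i.e., no I_j is properly contained in a subset I for which A_I has all entries equal). Fix B ∈ 𝒫_N(ℂ) with no zero diagonal entries, and positive reals c_0, …, c_{N−1}. Then ker(B ∘ (c_0·1_{N×N} + c_1 A + ⋯ + c_{N−1} A^{∘(N−1)})) = ∩_{n≥0} ker(B ∘ A^{∘n}) = ker B_{I_1} ⊕ ⋯ ⊕ ker B_{I_k}, where B_{I_j} are the diagonal blocks of B corresponding to the partition and the direct sum is taken inside ℂ^N via the coordinate decomposition ℂ^N = ℂ^{I_1} ⊕ ⋯ ⊕ ℂ^{I_k}. -/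
open scoped ComplexOrder Matrix

noncomputable section

open Finset Polynomial in
/-- If the first `card ι` power moments of the weights `u` at the nodes `a` vanish, then so does
the total weight at each node. -/
theorem sum_ite_eq_zero_of_sum_pow_mul_eq_zero {ι K : Type*} [Fintype ι] [Field K] [DecidableEq K]
    (a u : ι → K) (h : ∀ k < Fintype.card ι, ∑ j, a j ^ k * u j = 0) (i : ι) :
    ∑ j, (if a j = a i then u j else 0) = 0 := by
  set S := univ.image a
  have hmem (j : ι) : a j ∈ S := mem_image_of_mem a (mem_univ j)
  set p : K[X] := Lagrange.basis S id (a i)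
  have hdeg : p.natDegree < Fintype.card ι := by
    have hp : p.degree = ((#S - 1 : ℕ) : WithBot ℕ) :=
      Lagrange.degree_basis Function.injective_id.injOn (hmem i)
    have hcard : #S ≤ Fintype.card ι := card_image_le
    have hpos : 0 < #S := card_pos.mpr ⟨_, hmem i⟩
    rw [natDegree_eq_of_degree_eq_some hp]
    omega
  calc ∑ j, (if a j = a i then u j else 0) = ∑ j, p.eval (a j) * u j := by
        refine sum_congr rfl fun j _ ↦ ?_
        split_ifs with hj
        · have := Lagrange.eval_basis_self (Function.injective_id (α := K)).injOn (hmem i)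
          rw [id] at this
          rw [hj, this, one_mul]
        · have := Lagrange.eval_basis_of_ne (v := (id : K → K)) (Ne.symm hj) (hmem j)
          rw [id] at this
          rw [this, zero_mul]
    _ = ∑ k ∈ range (Fintype.card ι), p.coeff k * ∑ j, a j ^ k * u j := by
        simp_rw [eval_eq_sum_range' hdeg, sum_mul, mul_sum, mul_assoc]
        exact sum_comm
    _ = 0 := sum_eq_zero fun k hk ↦ by rw [h k (mem_range.mp hk), mul_zero]

namespace Matrix.PosSemidef

variable {ι 𝕜 : Type*} [RCLike 𝕜] {A B : Matrix ι ι 𝕜}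

theorem apply_eq_of_apply_eq_diag (hA : A.PosSemidef) {i j : ι} (h : A i j = A i i) :
    A j i = A i i := by
  rw [← hA.isHermitian.apply j i, h, hA.isHermitian.apply]

theorem hadamard_pow_s19 [Finite ι] (hA : A.PosSemidef) (hB : B.PosSemidef) (n : ℕ) :
    (Matrix.of fun i j ↦ B i j * A i j ^ n).PosSemidef := by
  induction n with
  | zero =>
    simp only [pow_zero, mul_one]
    exact hB
  | succ n ih =>
    convert ih.hadamard hA using 1
    ext i j
    simp [pow_succ, mul_assoc]

variable [Fintype ι]

open Classical in
theorem dotProduct_mulVec_single_sub_single (hA : A.PosSemidef) {i j : ι} (h : A i j = A i i) :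
    star (Pi.single i 1 - Pi.single j 1 : ι → 𝕜) ⬝ᵥ (A *ᵥ (Pi.single i 1 - Pi.single j 1)) =
      A j j - A i i := by
  simp [mulVec_sub, sub_dotProduct, dotProduct_sub, h, hA.apply_eq_of_apply_eq_diag h,
    Pi.star_single]

theorem diag_le_of_apply_eq_diag (hA : A.PosSemidef) {i j : ι} (h : A i j = A i i) :
    A i i ≤ A j j := by
  classical
  rw [← sub_nonneg, ← hA.dotProduct_mulVec_single_sub_single h]
  exact hA.dotProduct_mulVec_nonneg _

theorem col_eq_of_apply_eq_diag (hA : A.PosSemidef) {i j : ι} (h : A i j = A i i)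
    (hj : A j j = A i i) (k : ι) : A k i = A k j := by
  classical
  have h0 := hA.dotProduct_mulVec_single_sub_single h
  rw [hj, sub_self, hA.dotProduct_mulVec_zero_iff] at h0
  simpa [mulVec_sub, sub_eq_zero] using congrFun h0 k

/-- A null vector of a principal block, extended by zero, is a null vector of the whole matrix. -/
theorem sum_mul_eq_zero_of_block (hB : B.PosSemidef) (s : Finset ι) (v : ι → 𝕜)
    (h : ∀ i ∈ s, ∑ j ∈ s, B i j * v j = 0) (i : ι) : ∑ j ∈ s, B i j * v j = 0 := by
  classical
  set w : ι → 𝕜 := fun j ↦ if j ∈ s then v j else 0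
  have hw (i : ι) : (B *ᵥ w) i = ∑ j ∈ s, B i j * v j := by
    simp [mulVec, dotProduct, w]
  have h0 : star w ⬝ᵥ (B *ᵥ w) = 0 := by
    refine Finset.sum_eq_zero fun i _ ↦ ?_
    by_cases hi : i ∈ s
    · rw [hw, h i hi, mul_zero]
    · simp [w, hi]
  rw [hB.dotProduct_mulVec_zero_iff] at h0
  rw [← hw, h0, Pi.zero_apply]

/-- The kernel of a sum of positive semidefinite matrices is the intersection of the kernels. -/
theorem mulVec_eq_zero_of_sum_mulVec_eq_zero_s19 {κ : Type*} {s : Finset κ} {M : κ → Matrix ι ι 𝕜}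
    (hM : ∀ k ∈ s, (M k).PosSemidef) {v : ι → 𝕜} (h : (∑ k ∈ s, M k) *ᵥ v = 0) {k : κ}
    (hk : k ∈ s) : M k *ᵥ v = 0 := by
  have h0 : ∑ k ∈ s, star v ⬝ᵥ (M k *ᵥ v) = 0 := by
    rw [← dotProduct_sum, ← sum_mulVec, h, dotProduct_zero]
  rw [Finset.sum_eq_zero_iff_of_nonneg fun k hk ↦ (hM k hk).dotProduct_mulVec_nonneg v] at h0
  exact ((hM k hk).dotProduct_mulVec_zero_iff v).mp (h0 k hk)

/-- If all Hadamard moments `B ∘ A^{∘k}` with `k < card ι` annihilate `v`, then so does each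
diagonal block of `B` in the partition `P` into the classes of `A i j = A i i = A j j`. -/
theorem sum_block_eq_zero_of_moments (hA : A.PosSemidef) (hB : B.PosSemidef)
    {P : Finset (Finset ι)} (hdisj : (P : Set (Finset ι)).PairwiseDisjoint id)
    (hcover : ∀ i, ∃ s ∈ P, i ∈ s)
    (hmem : ∀ s ∈ P, ∀ i ∈ s, ∀ j, j ∈ s ↔ A i j = A i i ∧ A j j = A i i) {v : ι → 𝕜}
    (h : ∀ k < Fintype.card ι, ∀ i, ∑ j, A i j ^ k * (B i j * v j) = 0) (i : ι) :
    ∀ s ∈ P, i ∈ s → ∑ j ∈ s, B i j * v j = 0 := by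
  classical
  have hwf : WellFounded fun i j : ι ↦ A j j < A i i :=
    haveI : IsTrans ι fun i j ↦ A j j < A i i := ⟨fun _ _ _ h₁ h₂ ↦ h₂.trans h₁⟩
    haveI : Std.Irrefl fun i j : ι ↦ A j j < A i i := ⟨fun _ ↦ lt_irrefl _⟩
    Finite.wellFounded_of_trans_of_irrefl _
  induction i using hwf.induction with
  | h i ih =>
  intro s hs hi
  have hsum := sum_ite_eq_zero_of_sum_pow_mul_eq_zero (A i) (fun j ↦ B i j * v j)
    (fun k hk ↦ h k hk i) i
  have huniv : (Finset.univ : Finset ι) = P.biUnion id := by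
    ext j
    simpa using hcover j
  rw [huniv, Finset.sum_biUnion hdisj, Finset.sum_eq_single_of_mem s hs] at hsum
  · rw [← hsum]
    exact Finset.sum_congr rfl fun j hj ↦ (if_pos ((hmem s hs i hi j).mp hj).1).symm
  · intro t ht hts
    by_cases hex : ∃ j ∈ t, A i j = A i i
    · obtain ⟨j, hj, hij⟩ := hex
      have hcol (p : ι) (hp : p ∈ t) : A i p = A i i := by
        obtain ⟨h₁, h₂⟩ := (hmem t ht j hj p).mp hp
        rw [← hij, ← hA.col_eq_of_apply_eq_diag h₁ h₂]
      refine (Finset.sum_congr rfl fun p hp ↦ if_pos (hcol p hp)).trans ?_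
      refine hB.sum_mul_eq_zero_of_block t v (fun p hp ↦ ih p ?_ t ht hp) i
      refine (hA.diag_le_of_apply_eq_diag (hcol p hp)).lt_of_ne fun heq ↦ ?_
      exact Finset.disjoint_left.mp (hdisj ht hs hts) hp
        ((hmem s hs i hi p).mpr ⟨hcol p hp, heq.symm⟩)
    · push Not at hex
      exact Finset.sum_eq_zero fun j hj ↦ if_neg (hex j hj)

/-- If each diagonal block of `B` in the partition `P` annihilates `v`, then so does every
Hadamard moment `B ∘ A^{∘n}`. -/
theorem sum_moment_eq_zero_of_block (hA : A.PosSemidef) (hB : B.PosSemidef)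
    {P : Finset (Finset ι)} (hdisj : (P : Set (Finset ι)).PairwiseDisjoint id)
    (hcover : ∀ i, ∃ s ∈ P, i ∈ s)
    (hmem : ∀ s ∈ P, ∀ i ∈ s, ∀ j, j ∈ s ↔ A i j = A i i ∧ A j j = A i i) {v : ι → 𝕜}
    (h : ∀ s ∈ P, ∀ i ∈ s, ∑ j ∈ s, B i j * v j = 0) (n : ℕ) (i : ι) :
    ∑ j, B i j * A i j ^ n * v j = 0 := by
  classical
  have huniv : (Finset.univ : Finset ι) = P.biUnion id := by
    ext j
    simpa using hcover j
  rw [huniv, Finset.sum_biUnion hdisj]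
  refine Finset.sum_eq_zero fun s hs ↦ ?_
  obtain rfl | ⟨j, hj⟩ := s.eq_empty_or_nonempty
  · simp
  calc ∑ p ∈ s, B i p * A i p ^ n * v p = A i j ^ n * ∑ p ∈ s, B i p * v p := by
        rw [Finset.mul_sum]
        refine Finset.sum_congr rfl fun p hp ↦ ?_
        obtain ⟨h₁, h₂⟩ := (hmem s hs j hj p).mp hp
        rw [hA.col_eq_of_apply_eq_diag h₁ h₂]
        ring
    _ = 0 := by rw [hB.sum_mul_eq_zero_of_block s v (h s hs), mul_zero]

/-- A maximal set on which `A` is constant is a class of the relation `A i j = A i i = A j j`. -/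
theorem mem_iff_of_maximal_const (hA : A.PosSemidef) {s : Finset ι}
    (hconst : ∃ z, ∀ p ∈ s, ∀ q ∈ s, A p q = z)
    (hmax : ∀ I : Finset ι, s ⊆ I → (∃ z, ∀ p ∈ I, ∀ q ∈ I, A p q = z) → I = s)
    {i : ι} (hi : i ∈ s) (j : ι) : j ∈ s ↔ A i j = A i i ∧ A j j = A i i := by
  classical
  obtain ⟨z, hz⟩ := hconst
  have hsub (j : ι) (hj : j ∈ s) : A i j = A i i ∧ A j j = A i i := by
    simp [hz _ hi _ hi, hz _ hi _ hj, hz _ hj _ hj]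
  refine ⟨hsub j, fun hj ↦ ?_⟩
  have hI := hmax {k | A i k = A i i ∧ A k k = A i i}
    (fun j hj ↦ by simpa using hsub j hj) ⟨A i i, fun p hp q hq ↦ by
      simp only [Finset.mem_filter_univ] at hp hq
      rw [← hA.col_eq_of_apply_eq_diag hq.1 hq.2, hA.apply_eq_of_apply_eq_diag hp.1]⟩
  rw [← hI]
  simpa using hj

end Matrix.PosSemidef

theorem stmt_19 (N : ℕ) (hN : 1 ≤ N)
    (A : Matrix (Fin N) (Fin N) ℂ) (hA : A.PosSemidef)
    (P : Finset (Finset (Fin N)))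
    (hPne : ∀ s ∈ P, s.Nonempty)
    (hPdisj : (P : Set (Finset (Fin N))).PairwiseDisjoint id)
    (hPcover : ∀ i : Fin N, ∃ s ∈ P, i ∈ s)
    (hPconst : ∀ s ∈ P, ∃ z : ℂ, ∀ p ∈ s, ∀ q ∈ s, A p q = z)
    (hPmax : ∀ s ∈ P, ∀ I : Finset (Fin N), s ⊆ I →
      (∃ z : ℂ, ∀ p ∈ I, ∀ q ∈ I, A p q = z) → I = s)
    (B : Matrix (Fin N) (Fin N) ℂ) (hB : B.PosSemidef) (hBd : ∀ i, B i i ≠ 0)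
    (c : Fin N → ℝ) (hc : ∀ j, 0 < c j) :
    { v : Fin N → ℂ |
        (Matrix.of fun i j => B i j * ∑ k : Fin N, (c k : ℂ) * A i j ^ (k : ℕ)) *ᵥ v = 0 }
      = { v : Fin N → ℂ | ∀ n : ℕ, (Matrix.of fun i j => B i j * A i j ^ n) *ᵥ v = 0 }
    ∧ { v : Fin N → ℂ | ∀ n : ℕ, (Matrix.of fun i j => B i j * A i j ^ n) *ᵥ v = 0 }
      = { v : Fin N → ℂ | ∀ s ∈ P,
          (Matrix.of fun p q : s => B p.1 q.1) *ᵥ (fun p : s => v p.1) = 0 } := by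
  have hmem : ∀ s ∈ P, ∀ i ∈ s, ∀ j, j ∈ s ↔ A i j = A i i ∧ A j j = A i i :=
    fun s hs i hi ↦ hA.mem_iff_of_maximal_const (hPconst s hs) (hPmax s hs) hi
  have hblock (s : Finset (Fin N)) (v : Fin N → ℂ) :
      (Matrix.of fun p q : s => B p.1 q.1) *ᵥ (fun p : s => v p.1) = 0 ↔
        ∀ i ∈ s, ∑ j ∈ s, B i j * v j = 0 := by
    simp only [funext_iff, Matrix.mulVec, dotProduct, Matrix.of_apply, Pi.zero_apply,
      Subtype.forall]
    refine forall₂_congr fun i _ ↦ ?_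
    rw [Finset.sum_coe_sort s fun j ↦ B i j * v j]
  have hsum : (Matrix.of fun i j => B i j * ∑ k : Fin N, (c k : ℂ) * A i j ^ (k : ℕ)) =
      ∑ k : Fin N, (c k : ℂ) • Matrix.of fun i j => B i j * A i j ^ (k : ℕ) := by
    ext i j
    simp [Matrix.sum_apply, Finset.mul_sum, mul_left_comm]
  have hmoments (v : Fin N → ℂ)
      (hv : ∀ k : Fin N, (Matrix.of fun i j => B i j * A i j ^ (k : ℕ)) *ᵥ v = 0) :
      ∀ s ∈ P, ∀ i ∈ s, ∑ j ∈ s, B i j * v j = 0 := by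
    refine fun s hs i hi ↦ hA.sum_block_eq_zero_of_moments hB hPdisj hPcover hmem
      (fun k hk i ↦ ?_) i s hs hi
    refine Eq.trans ?_ (congrFun (hv ⟨k, by simpa using hk⟩) i)
    simp only [Matrix.mulVec, dotProduct, Matrix.of_apply]
    exact Finset.sum_congr rfl fun j _ ↦ by ring
  have hblocks (v : Fin N → ℂ) (hv : ∀ s ∈ P, ∀ i ∈ s, ∑ j ∈ s, B i j * v j = 0) (n : ℕ) :
      (Matrix.of fun i j => B i j * A i j ^ n) *ᵥ v = 0 :=
    funext fun i ↦ hA.sum_moment_eq_zero_of_block hB hPdisj hPcover hmem hv n i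
  constructor
  · ext v
    simp only [Set.mem_ofPred_eq, hsum]
    refine ⟨fun h ↦ hblocks v (hmoments v fun k ↦ ?_), fun h ↦ ?_⟩
    · have hk := Matrix.PosSemidef.mulVec_eq_zero_of_sum_mulVec_eq_zero_s19
        (fun (k : Fin N) _ ↦ (hA.hadamard_pow_s19 hB k).smul (Complex.zero_le_real.mpr (hc k).le)) h
        (Finset.mem_univ k)
      rw [Matrix.smul_mulVec, smul_eq_zero] at hk
      exact hk.resolve_left (Complex.ofReal_ne_zero.mpr (hc k).ne')
    · simp only [Matrix.sum_mulVec, Matrix.smul_mulVec, h, smul_zero, Finset.sum_const_zero]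
  · ext v
    simp only [Set.mem_ofPred_eq, hblock]
    exact ⟨fun h ↦ hmoments v fun k ↦ h k, hblocks v⟩
end
end
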